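/- arXiv:1607.07200 — 11 statements merged into one kernel-verified Lean document; each statement's English description precedes it below -/
import Mathlib

section
/- Let G=(V,E) be an undirected supply graph with nonnegative edge weights w, and let H be an undirected demand graph whose vertex set is a subset of V. Let I_1,…,I_r be the maximal independent sets of H, used as a label set L={1,…,r}, and define assignment costs c(u,j)=0 if u is not a vertex of H or if u∈I_j, and c(u,j)=∞ otherwise. If f:V→L is a labeling of finite cost (i.e., c(u,f(u))=0 for every u), then the edge set E'={uv∈E : f(u)≠f(v)} satisfies: (i) the total weight of E' equals the uniform-metric-labeling cost of f, and (ii) E' is a feasible multicut, i.e., for every demand edge {s,t} of H, the vertices s and t lie in different connected components of G−E'. -/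
open scoped ENNReal Classical

/-- Undirected Multicut via Uniform Metric Labeling, direction 1.
`G` is the supply graph on the finite vertex set `V` with nonnegative edge weights `w`;
`H` is the demand graph, whose vertex set `VH` is a subset of `V` (`H.support ⊆ VH`).
`I 1, …, I r` are the maximal independent sets of `H` (each `I j ⊆ VH` is independent
and maximal, and every maximal independent set occurs among them); they serve as the
label set.  The assignment costs are `c u j = 0` if `u ∉ VH` or `u ∈ I j`, and `∞`
otherwise.  If the labeling `f : V → Fin r` has finite cost, i.e. `c u (f u) = 0` for
every `u`, then the cut edge set `E' = {uv ∈ E(G) : f u ≠ f v}` satisfies: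
(i) the total weight of `E'` equals the uniform-metric-labeling cost of `f`
    (assignment cost plus weight of the edges whose endpoints get different labels);
(ii) `E'` is a feasible multicut: for every demand edge `uv` of `H`, `u` and `v` are
    not connected in `G − E'`. -/
theorem stmt_0 {V : Type*} [Fintype V] [DecidableEq V]
    (G : SimpleGraph V) [DecidableRel G.Adj] (w : Sym2 V → NNReal)
    (VH : Set V) (H : SimpleGraph V) (hsupp : H.support ⊆ VH)
    (r : ℕ) (I : Fin r → Set V)
    (hsub : ∀ j, I j ⊆ VH)
    (hind : ∀ j, ∀ u ∈ I j, ∀ v ∈ I j, ¬ H.Adj u v)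
    (hmax : ∀ j, ∀ J : Set V, J ⊆ VH → (∀ u ∈ J, ∀ v ∈ J, ¬ H.Adj u v) →
      I j ⊆ J → J = I j)
    (hcomplete : ∀ J : Set V, J ⊆ VH → (∀ u ∈ J, ∀ v ∈ J, ¬ H.Adj u v) →
      (∀ J' : Set V, J' ⊆ VH → (∀ u ∈ J', ∀ v ∈ J', ¬ H.Adj u v) → J ⊆ J' → J' = J) →
      ∃ j, J = I j)
    (c : V → Fin r → ℝ≥0∞)
    (hc : ∀ u j, c u j = if u ∉ VH ∨ u ∈ I j then 0 else ⊤)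
    (f : V → Fin r) (hfin : ∀ u, c u (f u) = 0)
    (E' : Finset (Sym2 V))
    (hE' : E' = G.edgeFinset.filter fun e => ∃ a b, e = s(a, b) ∧ f a ≠ f b) :
    ((∑ e ∈ E', (w e : ℝ≥0∞))
        = (∑ u, c u (f u))
          + ∑ e ∈ G.edgeFinset.filter (fun e => ∃ a b, e = s(a, b) ∧ f a ≠ f b),
              (w e : ℝ≥0∞))
    ∧ ∀ u v, H.Adj u v → ¬ (G.deleteEdges (↑E' : Set (Sym2 V))).Reachable u v := by
  have key : ∀ u v, (G.deleteEdges (↑E' : Set (Sym2 V))).Reachable u v → f u = f v := by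
    rintro u v ⟨p⟩
    induction p with
    | nil => rfl
    | cons h p ih =>
      rw [← ih]
      rw [SimpleGraph.deleteEdges_adj] at h
      by_contra hne
      apply h.2
      rw [hE', Finset.mem_coe, Finset.mem_filter]
      exact ⟨by simpa using h.1, _, _, rfl, hne⟩
  have mem : ∀ u ∈ VH, u ∈ I (f u) := by
    intro u hu
    by_contra hn
    have h := hfin u
    rw [hc, if_neg (by tauto)] at h
    exact ENNReal.top_ne_zero h
  refine ⟨?_, ?_⟩
  · rw [Finset.sum_eq_zero (fun u _ => hfin u), zero_add, hE']
  · intro u v huv hr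
    have hu := mem u (hsupp ⟨v, huv⟩)
    have hv := mem v (hsupp ⟨u, huv.symm⟩)
    rw [← key u v hr] at hv
    exact hind _ u hu v hv huv
end

section
/- Let G=(V,E) be an undirected supply graph with nonnegative edge weights w, and let H be an undirected demand graph whose vertex set is a subset of V, having at least one maximal independent set I_1,…,I_r, used as a label set L={1,…,r} with assignment costs c(u,j)=0 if u is not a vertex of H or if u∈I_j, and c(u,j)=∞ otherwise. If E'⊆E is a feasible multicut for (G,H), then there exists a labeling f:V→L such that c(u,f(u))=0 for every u∈V (zero assignment cost) and Σ_{uv∈E, f(u)≠f(v)} w(uv) ≤ Σ_{e∈E'} w(e). -/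
open scoped Classical

/-- Undirected Multicut via Uniform Metric Labeling, direction 2.
`G` is the supply graph on the finite vertex set `V` with nonnegative edge weights `w`;
`H` is the demand graph, whose vertex set `VH` is a subset of `V` (`H.support ⊆ VH`).
`I 1, …, I r` (with `r ≥ 1`) are the maximal independent sets of `H`, used as labels,
with assignment cost `0` at `u` for label `j` iff `u ∉ VH` or `u ∈ I j` (and `∞`
otherwise).  If `E'` is a feasible multicut for `(G, H)`, then there is a labeling
`f : V → Fin r` of zero assignment cost (i.e. `u ∈ I (f u)` for every `u ∈ VH`) whose
cut-weight `Σ_{uv ∈ E(G), f u ≠ f v} w(uv)` is at most the weight of `E'`. -/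
theorem stmt_1 {V : Type*} [Fintype V] [DecidableEq V]
    (G : SimpleGraph V) [DecidableRel G.Adj] (w : Sym2 V → NNReal)
    (VH : Set V) (H : SimpleGraph V) (hsupp : H.support ⊆ VH)
    (r : ℕ) (hr : 0 < r) (I : Fin r → Set V)
    (hsub : ∀ j, I j ⊆ VH)
    (hind : ∀ j, ∀ u ∈ I j, ∀ v ∈ I j, ¬ H.Adj u v)
    (hmax : ∀ j, ∀ J : Set V, J ⊆ VH → (∀ u ∈ J, ∀ v ∈ J, ¬ H.Adj u v) →
      I j ⊆ J → J = I j)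
    (hcomplete : ∀ J : Set V, J ⊆ VH → (∀ u ∈ J, ∀ v ∈ J, ¬ H.Adj u v) →
      (∀ J' : Set V, J' ⊆ VH → (∀ u ∈ J', ∀ v ∈ J', ¬ H.Adj u v) → J ⊆ J' → J' = J) →
      ∃ j, J = I j)
    (E' : Finset (Sym2 V)) (hE'sub : (↑E' : Set (Sym2 V)) ⊆ G.edgeSet)
    (hfeas : ∀ u v, H.Adj u v →
      ¬ (G.deleteEdges (↑E' : Set (Sym2 V))).Reachable u v) :
    ∃ f : V → Fin r,
      (∀ u ∈ VH, u ∈ I (f u)) ∧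
      ∑ e ∈ G.edgeFinset.filter (fun e => ∃ a b, e = s(a, b) ∧ f a ≠ f b), w e
        ≤ ∑ e ∈ E', w e := by
  have key : ∀ c : (G.deleteEdges (↑E' : Set (Sym2 V))).ConnectedComponent, ∃ j : Fin r,
      ∀ u ∈ VH, (G.deleteEdges (↑E' : Set (Sym2 V))).connectedComponentMk u = c → u ∈ I j := by
    intro c
    have hS : {v | v ∈ VH ∧ (G.deleteEdges (↑E' : Set (Sym2 V))).connectedComponentMk v = c} ∈
        {J : Set V | J ⊆ VH ∧ ∀ u ∈ J, ∀ v ∈ J, ¬ H.Adj u v} := by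
      refine ⟨fun v hv => hv.1, ?_⟩
      rintro u ⟨-, hu⟩ v ⟨-, hv⟩ huv
      exact hfeas u v huv (SimpleGraph.ConnectedComponent.exact (hu.trans hv.symm))
    obtain ⟨J, hJ, hJmax⟩ := (Set.toFinite
      {J : Set V | J ⊆ VH ∧ ∀ u ∈ J, ∀ v ∈ J, ¬ H.Adj u v}).exists_le_maximal hS
    obtain ⟨j, rfl⟩ := hcomplete J hJmax.1.1 hJmax.1.2
      (fun J' h1 h2 h3 => Set.Subset.antisymm (hJmax.2 ⟨h1, h2⟩ h3) h3)
    exact ⟨j, fun u hu hc => hJ ⟨hu, hc⟩⟩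
  choose g hg using key
  refine ⟨fun v => g ((G.deleteEdges (↑E' : Set (Sym2 V))).connectedComponentMk v),
    fun u hu => hg _ u hu rfl, ?_⟩
  apply Finset.sum_le_sum_of_subset
  intro e he
  obtain ⟨he, a, b, rfl, hab⟩ := Finset.mem_filter.1 he
  by_contra hn
  apply hab
  have hadj : (G.deleteEdges (↑E' : Set (Sym2 V))).Adj a b := by
    rw [SimpleGraph.deleteEdges_adj]
    exact ⟨by simpa using he, by simpa using hn⟩
  exact congrArg g (SimpleGraph.ConnectedComponent.sound hadj.reachable)
end

section
/- Let G=(V,E) be a directed graph, let s_1,…,s_k ∈ V be terminals, and let L={0,1}^k with the componentwise partial order. Suppose that for each v∈V we are given a probability distribution z_v on L, that z_{s_i} is supported on {σ∈L : σ[i]=1} for every i, and that for two terminals s_i, s_j the distribution z_{s_j} is supported on {σ∈L : σ[i]=0}. Suppose further that each edge e=(u,v)∈E carries a value x_e ≥ 0 together with a nonnegative function z_e on L×L whose row marginals equal z_u, whose column marginals equal z_v, and with x_e = Σ_{(σ1,σ2): σ1 ≰ σ2} z_e(σ1,σ2). Then for every directed path p from s_i to s_j in G, Σ_{e∈p} x_e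 ≥ 1. -/
/-- Directed graph `G = (V, E)` with terminals `s 1, …, s k`, labels
`L = Fin k → Bool` ordered componentwise.  Each vertex `v` carries a probability
distribution `z v` on `L`; `z (s m)` is supported on `{σ | σ m = true}` for every `m`;
for the fixed pair of terminals `s i`, `s j` the distribution `z (s j)` is supported on
`{σ | σ i = false}`.  Each edge `e = (u,v) ∈ E` carries `x e ≥ 0` and a nonnegative
function `ze e` on `L × L` whose row marginals equal `z u`, whose column marginals equal
`z v`, and with `x e = Σ_{σ1 ≰ σ2} ze e σ1 σ2`.  Then every directed path from `s i`
to `s j` (encoded as a vertex list `s i :: p` forming a chain of edges of `E` and ending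
at `s j`) has total `x`-length at least `1`. -/
theorem stmt_3 {V : Type*} (k : ℕ) (E : Set (V × V)) (s : Fin k → V)
    (z : V → (Fin k → Bool) → ℝ)
    (hz0 : ∀ v σ, 0 ≤ z v σ)
    (hz1 : ∀ v, ∑ σ, z v σ = 1)
    (hterm : ∀ m : Fin k, ∀ σ, σ m = false → z (s m) σ = 0)
    (i j : Fin k)
    (hdem : ∀ σ, σ i = true → z (s j) σ = 0)
    (x : V × V → ℝ) (hx : ∀ e ∈ E, 0 ≤ x e)
    (ze : V × V → (Fin k → Bool) → (Fin k → Bool) → ℝ)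
    (hze0 : ∀ e ∈ E, ∀ σ1 σ2, 0 ≤ ze e σ1 σ2)
    (hrow : ∀ e ∈ E, ∀ σ1, ∑ σ2, ze e σ1 σ2 = z e.1 σ1)
    (hcol : ∀ e ∈ E, ∀ σ2, ∑ σ1, ze e σ1 σ2 = z e.2 σ2)
    (hxe : ∀ e ∈ E, x e = ∑ σ1 : Fin k → Bool, ∑ σ2 : Fin k → Bool,
        if ¬ (∀ m, σ1 m ≤ σ2 m) then ze e σ1 σ2 else 0)
    (p : List V)
    (hchain : List.Chain' (fun a b => (a, b) ∈ E) (s i :: p))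
    (hlast : (s i :: p).getLast (List.cons_ne_nil _ _) = s j) :
    1 ≤ (((s i :: p).zip p).map x).sum := by
  have hedge : ∀ e ∈ E, (∑ σ, if σ i = true then z e.1 σ else 0)
      - (∑ σ, if σ i = true then z e.2 σ else 0) ≤ x e := by
    intro e he
    have h1 : (∑ σ, if σ i = true then z e.1 σ else 0)
        = ∑ σ1 : Fin k → Bool, ∑ σ2 : Fin k → Bool,
          if σ1 i = true then ze e σ1 σ2 else 0 := by
      refine Finset.sum_congr rfl fun σ _ => ?_
      rw [← hrow e he σ]
      split_ifs <;> simp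
    have h2 : (∑ σ, if σ i = true then z e.2 σ else 0)
        = ∑ σ1 : Fin k → Bool, ∑ σ2 : Fin k → Bool,
          if σ2 i = true then ze e σ1 σ2 else 0 := by
      rw [Finset.sum_comm]
      refine Finset.sum_congr rfl fun σ _ => ?_
      rw [← hcol e he σ]
      split_ifs <;> simp
    rw [h1, h2, hxe e he, ← Finset.sum_sub_distrib]
    refine Finset.sum_le_sum fun σ1 _ => ?_
    rw [← Finset.sum_sub_distrib]
    refine Finset.sum_le_sum fun σ2 _ => ?_
    have h0 := hze0 e he σ1 σ2
    by_cases hle : ∀ m, σ1 m ≤ σ2 m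
    · have hi := hle i
      rw [if_neg (not_not.mpr hle)]
      revert hi
      cases σ1 i <;> cases σ2 i <;> intro hi
      · simp
      · simpa using h0
      · exact absurd hi (by decide)
      · simp
    · rw [if_pos hle]
      split_ifs <;> linarith
  have key : ∀ (p : List V) (a : V), List.IsChain (fun a b => (a, b) ∈ E) (a :: p) →
      (∑ σ, if σ i = true then z a σ else 0)
      - (∑ σ, if σ i = true then z ((a :: p).getLast (List.cons_ne_nil _ _)) σ else 0)
        ≤ (((a :: p).zip p).map x).sum := by
    intro p
    induction p with
    | nil => intro a _; simp
    | cons b q ih =>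
      intro a h
      rw [List.isChain_cons_cons] at h
      have h1 := ih b h.2
      have h2 := hedge (a, b) h.1
      rw [List.getLast_cons (List.cons_ne_nil b q), List.zip_cons_cons, List.map_cons,
        List.sum_cons]
      dsimp only at h2
      linarith
  have h := key p (s i) hchain
  rw [hlast] at h
  have hi : (∑ σ, if σ i = true then z (s i) σ else 0) = 1 := by
    rw [← hz1 (s i)]
    refine Finset.sum_congr rfl fun σ _ => ?_
    by_cases hs : σ i = true
    · rw [if_pos hs]
    · rw [if_neg hs, hterm i σ (by simpa using hs)]
  have hj : (∑ σ, if σ i = true then z (s j) σ else 0) = 0 := by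
    refine Finset.sum_eq_zero fun σ _ => ?_
    by_cases hs : σ i = true
    · rw [if_pos hs, hdem σ hs]
    · rw [if_neg hs]
  linarith
end

section
/- Let a,b ∈ [0,1]^k and let μ_a, μ_b be their chain distributions on L={0,1}^k. Then there exists a nonnegative function ν on L×L whose row marginals equal μ_a and whose column marginals equal μ_b such that Σ_{(σ1,σ2): σ1 ≰ σ2} ν(σ1,σ2) ≤ max(0, max_{1≤i≤k} (b_i − a_i)), where ≤ on L is the componentwise partial order. -/
/-- The `i`-th label `σ_i` of the chain determined by a permutation `π` of `Fin k`:
`σ_i j = true` iff `j ∈ {π 0, …, π (i−1)}`, i.e. iff `π⁻¹ j < i`. -/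
def chainLabel {k : ℕ} (π : Equiv.Perm (Fin k)) (i : Fin (k + 1)) : Fin k → Bool :=
  fun j => decide ((π.symm j : ℕ) < (i : ℕ))

/-- The mass that the chain distribution of `a` (sorted by `π`) puts on the label
`σ_i`: `a (π 0)` for `i = 0`, `a (π i) − a (π (i−1))` for `1 ≤ i ≤ k−1`, and
`1 − a (π (k−1))` for `i = k`. -/
noncomputable def chainVal {k : ℕ} (a : Fin k → ℝ) (π : Equiv.Perm (Fin k))
    (i : Fin (k + 1)) : ℝ :=
  (if h : (i : ℕ) < k then a (π ⟨(i : ℕ), h⟩) else 1)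
    - (if h : 0 < (i : ℕ) then a (π ⟨(i : ℕ) - 1, by have := i.isLt; omega⟩) else 0)

/-- `μ` is the chain distribution of `a` on `L = Fin k → Bool` relative to the sorting
permutation `π`: `π` sorts `a` nondecreasingly, `μ (σ_i) = chainVal a π i` for the
chain labels `σ_0, …, σ_k`, and `μ` vanishes on all other labels. -/
def IsChainDist {k : ℕ} (a : Fin k → ℝ) (π : Equiv.Perm (Fin k))
    (μ : (Fin k → Bool) → ℝ) : Prop :=
  (∀ i j : Fin k, i ≤ j → a (π i) ≤ a (π j)) ∧
  (∀ i : Fin (k + 1), μ (chainLabel π i) = chainVal a π i) ∧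
  (∀ τ : Fin k → Bool, (∀ i : Fin (k + 1), τ ≠ chainLabel π i) → μ τ = 0)


section Helpers
open MeasureTheory Set

/-- threshold label -/
noncomputable def thrLabel {k : ℕ} (a : Fin k → ℝ) (t : ℝ) : Fin k → Bool :=
  fun j => decide (a j ≤ t)

lemma thrLabel_measurable {k : ℕ} (a : Fin k → ℝ) : Measurable (thrLabel a) := by
  refine measurable_pi_iff.2 fun j => ?_
  refine measurable_to_bool ?_
  have : (fun t => thrLabel a t j) ⁻¹' {true} = Set.Ici (a j) := by
    ext t; simp [thrLabel]
  rw [this]; exact measurableSet_Ici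

lemma sum_fibers {k : ℕ} (f : ℝ → Fin k → Bool) (hf : Measurable f) (S : Set ℝ)
    (hS : MeasurableSet S) (hfin : volume S ≠ ⊤) :
    ∑ σ, volume.real (S ∩ f ⁻¹' {σ}) = volume.real S := by
  rw [← measureReal_biUnion_finset]
  · congr 1; ext t; simp
  · intro x _ y _ hxy
    refine Set.disjoint_left.2 ?_
    rintro t ⟨_, h1⟩ ⟨_, h2⟩
    exact hxy (by simp at h1 h2; rw [← h1, ← h2])
  · intro σ _
    exact hS.inter (hf (measurableSet_singleton σ))

lemma vol_thr {k : ℕ} (a : Fin k → ℝ) (ha : ∀ i, 0 ≤ a i ∧ a i ≤ 1)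
    (π : Equiv.Perm (Fin k)) (μ : (Fin k → Bool) → ℝ) (h : IsChainDist a π μ)
    (τ : Fin k → Bool) : volume.real (Ico 0 1 ∩ thrLabel a ⁻¹' {τ}) = μ τ := by
  obtain ⟨hs, h1, h2⟩ := h
  by_cases hτ : ∃ i, τ = chainLabel π i
  · obtain ⟨i, rfl⟩ := hτ
    rw [h1, chainVal]
    set hi : ℝ := (if h : (i : ℕ) < k then a (π ⟨(i : ℕ), h⟩) else 1) with hhi
    set lo : ℝ := (if h : 0 < (i : ℕ) then a (π ⟨(i : ℕ) - 1, by have := i.isLt; omega⟩) else 0)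
      with hlo
    have hle : lo ≤ hi := by
      rw [hlo, hhi]; split_ifs
      · apply hs; simp [Fin.le_def]
      · exact (ha _).2
      · exact (ha _).1
      · exact zero_le_one
    have : Ico 0 1 ∩ thrLabel a ⁻¹' {chainLabel π i} = Ico lo hi := by
      ext t
      have key : thrLabel a t = chainLabel π i ↔ ∀ m : Fin k, (a (π m) ≤ t ↔ (m : ℕ) < i) := by
        rw [funext_iff]
        constructor
        · intro h m
          have := h (π m)
          simpa [thrLabel, chainLabel] using this
        · intro h j
          have := h (π.symm j)
          simpa [thrLabel, chainLabel] using this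
      simp only [mem_inter_iff, mem_Ico, mem_preimage, mem_singleton_iff, key]
      constructor
      · rintro ⟨⟨t0, t1⟩, h⟩
        constructor
        · rw [hlo]; split_ifs with hc
          · rw [h]; show (i : ℕ) - 1 < i; omega
          · exact t0
        · rw [hhi]; split_ifs with hc
          · rw [← not_le, h]; simp
          · exact t1
      · rintro ⟨l1, l2⟩
        have lo0 : 0 ≤ lo := by
          rw [hlo]; split_ifs
          · exact (ha _).1
          · exact le_rfl
        have hi1 : hi ≤ 1 := by
          rw [hhi]; split_ifs
          · exact (ha _).2
          · exact le_rfl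
        refine ⟨⟨lo0.trans l1, l2.trans_le hi1⟩, fun m => ⟨fun h => ?_, fun h => ?_⟩⟩
        · by_contra hc
          have hik : (i : ℕ) < k := by have := m.isLt; omega
          rw [hhi, dif_pos hik] at l2
          have := hs ⟨i, hik⟩ m (by simp [Fin.le_def]; omega)
          linarith
        · have hi0 : 0 < (i : ℕ) := by omega
          rw [hlo, dif_pos hi0] at l1
          refine le_trans (hs _ _ ?_) l1
          simp [Fin.le_def]; omega
    rw [this, Real.volume_real_Ico_of_le hle]
  · push Not at hτ
    rw [h2 τ hτ]
    have : Ico 0 1 ∩ thrLabel a ⁻¹' {τ} = ∅ := by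
      refine eq_empty_of_forall_notMem ?_
      rintro t ⟨_, ht⟩
      have ht : thrLabel a t = τ := ht
      classical
      have hex : ∃ n : ℕ, ∀ m : Fin k, n ≤ m → t < a (π m) :=
        ⟨k, fun m hm => absurd m.isLt (by omega)⟩
      have hnk : Nat.find hex ≤ k :=
        Nat.find_min' hex (fun m hm => absurd m.isLt (by omega))
      apply hτ ⟨Nat.find hex, by omega⟩
      rw [← ht]
      funext j
      simp only [thrLabel, chainLabel]
      congr 1
      apply propext
      constructor
      · intro h
        by_contra hc
        have := Nat.find_spec hex (π.symm j) (by omega)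
        simp at this; linarith
      · intro h
        have := Nat.find_min hex h
        push Not at this
        obtain ⟨m', h3, h4⟩ := this
        have := hs (π.symm j) m' h3
        simp at this; linarith
    rw [this]; simp

lemma vol_shift (S : Set ℝ) (c : ℝ) : volume.real ((fun t => t + c) ⁻¹' S) = volume.real S := by
  rw [measureReal_def, measureReal_def, measure_preimage_add_right]

end Helpers

/-- For `a, b ∈ [0,1]^k` (`k ≥ 1`) with chain distributions `μa`, `μb`
on `L = Fin k → Bool`, there is a coupling `ν` of `μa` and `μb` (nonnegative, row
marginals `μa`, column marginals `μb`) whose mass on pairs `(σ1, σ2)` with `σ1 ≰ σ2`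
in the componentwise order is at most `max 0 (max_i (b i − a i))`. -/
theorem stmt_5 {k : ℕ} (hk : 0 < k) (a b : Fin k → ℝ)
    (ha : ∀ i, 0 ≤ a i ∧ a i ≤ 1) (hb : ∀ i, 0 ≤ b i ∧ b i ≤ 1)
    (πa πb : Equiv.Perm (Fin k)) (μa μb : (Fin k → Bool) → ℝ)
    (hμa : IsChainDist a πa μa) (hμb : IsChainDist b πb μb) :
    ∃ ν : (Fin k → Bool) → (Fin k → Bool) → ℝ,
      (∀ σ1 σ2, 0 ≤ ν σ1 σ2) ∧
      (∀ σ1, ∑ σ2, ν σ1 σ2 = μa σ1) ∧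
      (∀ σ2, ∑ σ1, ν σ1 σ2 = μb σ2) ∧
      (∑ σ1 : Fin k → Bool, ∑ σ2 : Fin k → Bool,
          if ¬ (∀ j, σ1 j ≤ σ2 j) then ν σ1 σ2 else 0)
        ≤ max 0 (Finset.univ.sup' ⟨⟨0, hk⟩, Finset.mem_univ _⟩ fun i => b i - a i) := by
  set M := Finset.univ.sup' ⟨⟨0, hk⟩, Finset.mem_univ _⟩ fun i => b i - a i with hM
  set D := max 0 M with hD
  have hD0 : 0 ≤ D := le_max_left _ _
  have hDi : ∀ i, b i - a i ≤ D := fun i =>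
    (Finset.le_sup' (fun i => b i - a i) (Finset.mem_univ i)).trans (le_max_right _ _)
  have hD1 : D ≤ 1 := by
    refine max_le zero_le_one (Finset.sup'_le _ _ fun i _ => ?_)
    have := ha i; have := hb i; linarith
  clear_value D
  have mA := thrLabel_measurable a
  have mB := thrLabel_measurable b
  have mB1 : Measurable (fun t => thrLabel b (t + D)) := mB.comp (measurable_id.add_const D)
  have mB2 : Measurable (fun t => thrLabel b (t + (D - 1))) :=
    mB.comp (measurable_id.add_const (D - 1))
  have fA : ∀ σ, MeasurableSet (thrLabel a ⁻¹' {σ}) := fun σ => mA (measurableSet_singleton σ)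
  have fB : ∀ σ, MeasurableSet (thrLabel b ⁻¹' {σ}) := fun σ => mB (measurableSet_singleton σ)
  have fB1 : ∀ σ, MeasurableSet ((fun t => thrLabel b (t + D)) ⁻¹' {σ}) :=
    fun σ => mB1 (measurableSet_singleton σ)
  have fB2 : ∀ σ, MeasurableSet ((fun t => thrLabel b (t + (D - 1))) ⁻¹' {σ}) :=
    fun σ => mB2 (measurableSet_singleton σ)
  have fin : ∀ (x y : ℝ) (T : Set ℝ), MeasureTheory.volume (Set.Ico x y ∩ T) ≠ ⊤ := fun x y T =>
    MeasureTheory.measure_ne_top_of_subset Set.inter_subset_left (by simp)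
  -- splitting [0,1) at a point
  have split : ∀ (c : ℝ), 0 ≤ c → c ≤ 1 → ∀ T : Set ℝ, MeasurableSet T →
      MeasureTheory.volume.real (Set.Ico 0 c ∩ T) + MeasureTheory.volume.real (Set.Ico c 1 ∩ T) = MeasureTheory.volume.real (Set.Ico 0 1 ∩ T) := by
    intro c h0 h1 T hT
    rw [← MeasureTheory.measureReal_union _ (measurableSet_Ico.inter hT) (fin _ _ _) (fin _ _ _),
      ← Set.union_inter_distrib_right, Set.Ico_union_Ico_eq_Ico h0 h1]
    refine Set.disjoint_left.2 ?_
    rintro t ⟨h1, _⟩ ⟨h2, _⟩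
    exact absurd h1.2 (not_lt.2 h2.1)
  have row : ∀ (x y : ℝ) (g : ℝ → Fin k → Bool), Measurable g → ∀ σ1,
      ∑ σ2, MeasureTheory.volume.real (Set.Ico x y ∩ thrLabel a ⁻¹' {σ1} ∩ g ⁻¹' {σ2})
        = MeasureTheory.volume.real (Set.Ico x y ∩ thrLabel a ⁻¹' {σ1}) := fun x y g hg σ1 =>
    sum_fibers g hg _ (measurableSet_Ico.inter (fA σ1)) (fin _ _ _)
  have col : ∀ (x y : ℝ) (g : ℝ → Fin k → Bool), Measurable g → ∀ σ2,
      ∑ σ1, MeasureTheory.volume.real (Set.Ico x y ∩ thrLabel a ⁻¹' {σ1} ∩ g ⁻¹' {σ2})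
        = MeasureTheory.volume.real (Set.Ico x y ∩ g ⁻¹' {σ2}) := fun x y g hg σ2 => by
    simp_rw [Set.inter_right_comm]
    exact sum_fibers _ mA _ (measurableSet_Ico.inter (hg (measurableSet_singleton σ2))) (fin _ _ _)
  refine ⟨fun σ1 σ2 =>
    MeasureTheory.volume.real (Set.Ico 0 (1 - D) ∩ thrLabel a ⁻¹' {σ1} ∩ (fun t => thrLabel b (t + D)) ⁻¹' {σ2})
    + MeasureTheory.volume.real (Set.Ico (1 - D) 1 ∩ thrLabel a ⁻¹' {σ1} ∩
        (fun t => thrLabel b (t + (D - 1))) ⁻¹' {σ2}), ?_, ?_, ?_, ?_⟩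
  · intro σ1 σ2; positivity
  · intro σ1
    rw [Finset.sum_add_distrib, row _ _ _ mB1, row _ _ _ mB2,
      split _ (by linarith) (by linarith) _ (fA σ1)]
    exact vol_thr a ha πa μa hμa σ1
  · intro σ2
    rw [Finset.sum_add_distrib, col _ _ _ mB1, col _ _ _ mB2]
    have e1 : Set.Ico 0 (1 - D) ∩ (fun t => thrLabel b (t + D)) ⁻¹' {σ2}
        = (fun t => t + D) ⁻¹' (Set.Ico D 1 ∩ thrLabel b ⁻¹' {σ2}) := by
      ext t
      simp only [Set.mem_inter_iff, Set.mem_Ico, Set.mem_preimage, Set.mem_singleton_iff]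
      refine and_congr_left fun _ => ⟨fun h => ⟨by linarith, by linarith⟩,
        fun h => ⟨by linarith, by linarith⟩⟩
    have e2 : Set.Ico (1 - D) 1 ∩ (fun t => thrLabel b (t + (D - 1))) ⁻¹' {σ2}
        = (fun t => t + (D - 1)) ⁻¹' (Set.Ico 0 D ∩ thrLabel b ⁻¹' {σ2}) := by
      ext t
      simp only [Set.mem_inter_iff, Set.mem_Ico, Set.mem_preimage, Set.mem_singleton_iff]
      refine and_congr_left fun _ => ⟨fun h => ⟨by linarith, by linarith⟩,
        fun h => ⟨by linarith, by linarith⟩⟩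
    rw [e1, e2, vol_shift, vol_shift, add_comm, split D hD0 hD1 _ (fB σ2)]
    exact vol_thr b hb πb μb hμb σ2
  · calc _ ≤ ∑ σ1 : Fin k → Bool, ∑ σ2 : Fin k → Bool,
          MeasureTheory.volume.real (Set.Ico (1 - D) 1 ∩ thrLabel a ⁻¹' {σ1} ∩
            (fun t => thrLabel b (t + (D - 1))) ⁻¹' {σ2}) := by
          refine Finset.sum_le_sum fun σ1 _ => Finset.sum_le_sum fun σ2 _ => ?_
          split_ifs with hc
          · positivity
          · have : Set.Ico 0 (1 - D) ∩ thrLabel a ⁻¹' {σ1} ∩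
                (fun t => thrLabel b (t + D)) ⁻¹' {σ2} = ∅ := by
              refine Set.eq_empty_of_forall_notMem ?_
              rintro t ⟨⟨_, h1⟩, h2⟩
              have h1 : thrLabel a t = σ1 := h1
              have h2 : thrLabel b (t + D) = σ2 := h2
              apply hc
              intro j
              rw [← h1, ← h2, Bool.le_iff_imp]
              simp only [thrLabel, decide_eq_true_eq]
              intro h
              have := hDi j
              linarith
            beta_reduce; rw [this]; simp
      _ = MeasureTheory.volume.real (Set.Ico (1 - D) 1) := by
          simp_rw [row _ _ _ mB2]
          exact sum_fibers _ mA _ measurableSet_Ico (by simp)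
      _ = D := by rw [Real.volume_real_Ico_of_le (by linarith)]; ring
      _ ≤ D := le_rfl
end

section
/- Let L be a finite set, let c : L×L → {0,1} be a cost function, let μ and ν be probability distributions on L, and let ρ : L×L → ℝ≥0 be a partial coupling supported on zero-cost pairs (ρ(σ,σ')>0 implies c(σ,σ')=0) whose row sums are at most μ and whose column sums are at most ν, with total mass γ = Σ_{σ,σ'} ρ(σ,σ'). Then there exists ρ' : L×L → ℝ≥0 with ρ' ≥ ρ pointwise, whose row marginals equal μ and whose column marginals equal ν, such that Σ_{σ,σ'} c(σ,σ')·ρ'(σ,σ') ≤ 1 − γ. -/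
/-- Completing a partial coupling supported on zero-cost pairs.
`L` is a finite label set, `c : L × L → {0,1}` a cost function, `μ, ν` probability
distributions on `L`, and `ρ` a nonnegative partial coupling whose positive entries
have zero cost, whose row sums are at most `μ` and column sums at most `ν`, of total
mass `γ`.  Then `ρ` extends to a full coupling `ρ' ≥ ρ` of `μ` and `ν` whose total
cost is at most `1 − γ`. -/
theorem stmt_6 {L : Type*} [Fintype L]
    (c : L → L → ℝ) (hc : ∀ σ σ', c σ σ' = 0 ∨ c σ σ' = 1)
    (μ ν : L → ℝ)
    (hμ0 : ∀ σ, 0 ≤ μ σ) (hμ1 : ∑ σ, μ σ = 1)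
    (hν0 : ∀ σ, 0 ≤ ν σ) (hν1 : ∑ σ, ν σ = 1)
    (ρ : L → L → ℝ) (hρ0 : ∀ σ σ', 0 ≤ ρ σ σ')
    (hρc : ∀ σ σ', 0 < ρ σ σ' → c σ σ' = 0)
    (hρrow : ∀ σ, ∑ σ', ρ σ σ' ≤ μ σ)
    (hρcol : ∀ σ', ∑ σ, ρ σ σ' ≤ ν σ')
    (γ : ℝ) (hγ : γ = ∑ σ, ∑ σ', ρ σ σ') :
    ∃ ρ' : L → L → ℝ,
      (∀ σ σ', ρ σ σ' ≤ ρ' σ σ') ∧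
      (∀ σ σ', 0 ≤ ρ' σ σ') ∧
      (∀ σ, ∑ σ', ρ' σ σ' = μ σ) ∧
      (∀ σ', ∑ σ, ρ' σ σ' = ν σ') ∧
      ∑ σ, ∑ σ', c σ σ' * ρ' σ σ' ≤ 1 - γ := by
  have ha0 : ∀ σ, 0 ≤ μ σ - ∑ σ', ρ σ σ' := fun σ => sub_nonneg.2 (hρrow σ)
  have hb0 : ∀ σ', 0 ≤ ν σ' - ∑ σ, ρ σ σ' := fun σ => sub_nonneg.2 (hρcol σ)
  have hasum : ∑ σ, (μ σ - ∑ σ', ρ σ σ') = 1 - γ := by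
    rw [Finset.sum_sub_distrib, hμ1, hγ]
  have hbsum : ∑ σ', (ν σ' - ∑ σ, ρ σ σ') = 1 - γ := by
    rw [Finset.sum_sub_distrib, hν1, hγ, Finset.sum_comm]
  have hg : 0 ≤ 1 - γ := hasum ▸ Finset.sum_nonneg (fun σ _ => ha0 σ)
  have hz : ∀ f : L → ℝ, (∀ σ, 0 ≤ f σ) → ∑ σ, f σ = 1 - γ →
      ∀ σ, f σ * (1 - γ) / (1 - γ) = f σ := by
    intro f hf hs σ
    by_cases h : 1 - γ = 0
    · rw [h] at hs
      have := (Finset.sum_eq_zero_iff_of_nonneg (fun σ _ => hf σ)).1 hs σ (Finset.mem_univ σ)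
      simp [this]
    · field_simp
  have hd : ∀ σ σ', 0 ≤ (μ σ - ∑ τ, ρ σ τ) * (ν σ' - ∑ τ, ρ τ σ') / (1 - γ) :=
    fun σ σ' => div_nonneg (mul_nonneg (ha0 σ) (hb0 σ')) hg
  have hrow : ∀ σ, ∑ σ', (ρ σ σ' + (μ σ - ∑ τ, ρ σ τ) * (ν σ' - ∑ τ, ρ τ σ') / (1 - γ)) = μ σ := by
    intro σ
    rw [Finset.sum_add_distrib, ← Finset.sum_div, ← Finset.mul_sum, hbsum, hz _ ha0 hasum]
    ring
  refine ⟨fun σ σ' => ρ σ σ' + (μ σ - ∑ τ, ρ σ τ) * (ν σ' - ∑ τ, ρ τ σ') / (1 - γ),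
    fun σ σ' => le_add_of_nonneg_right (hd σ σ'),
    fun σ σ' => add_nonneg (hρ0 σ σ') (hd σ σ'), hrow, ?_, ?_⟩
  · intro σ'
    rw [Finset.sum_add_distrib, ← Finset.sum_div, ← Finset.sum_mul, hasum, mul_comm,
      hz _ hb0 hbsum]
    ring
  · calc _ ≤ ∑ σ, ∑ σ', ((ρ σ σ' + (μ σ - ∑ τ, ρ σ τ) * (ν σ' - ∑ τ, ρ τ σ') / (1 - γ))
            - ρ σ σ') := by
          refine Finset.sum_le_sum fun σ _ => Finset.sum_le_sum fun σ' _ => ?_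
          have h1 := hd σ σ'
          rcases hc σ σ' with h | h
          · rw [h]; linarith
          · have h2 : ρ σ σ' ≤ 0 := by
              by_contra hn
              have := hρc σ σ' (not_le.1 hn)
              linarith
            rw [h]; linarith
      _ = 1 - γ := by
          simp_rw [Finset.sum_sub_distrib, hrow]
          rw [hμ1, hγ]
end

section
/- Let G=(V,E) be a directed supply graph with nonnegative edge weights, terminals s_1,…,s_k ∈ V, and directed demand graph H on the terminals. Then the optimum value of the Distance-LP for (G,H) equals the optimum value of the Label-LP for (G,H); moreover the optimum values over integral (binary) solutions of the two formulations are also equal. Concretely: for every feasible solution (x,z) of the Label-LP, the vector x is a feasible solution of the Distance-LP with the same cost; and for every feasible solution x of the Distance-LP there is a feasible solution (x',z') of the Label-LP with x'_e ≤ x_e for every edge e, hence of cost at most that of x. -/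
/-- Feasibility for the Distance-LP of directed Multicut: `x ≥ 0` on the edges, and
every directed path (encoded as a vertex list `s i :: p` forming a chain of edges of
`E`) from `s i` to `s j`, for a demand pair `D i j`, has total `x`-length at least 1. -/
def DistFeas {V : Type*} (E : Set (V × V)) {k : ℕ} (s : Fin k → V)
    (D : Fin k → Fin k → Prop) (x : V × V → ℝ) : Prop :=
  (∀ e ∈ E, 0 ≤ x e) ∧
  ∀ i j, D i j → ∀ p : List V,
    List.Chain' (fun a b => (a, b) ∈ E) (s i :: p) →
    (s i :: p).getLast (List.cons_ne_nil _ _) = s j →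
    1 ≤ (((s i :: p).zip p).map x).sum

/-- Feasibility for the Label-LP of directed Multicut, with label set
`L = Fin k → Bool` ordered componentwise: all variables lie in `[0,1]`; `zv v` is a
distribution on `L` for each vertex `v`; `zv (s i)` vanishes on labels with `σ i = 0`;
`zv (s j)` vanishes on labels with `σ i = 1` whenever `D i j` is a demand edge; for
each edge `e = (u,v) ∈ E` the row/column marginals of `ze e` are `zv u` / `zv v`; and
`x e` is the `ze e`-mass of pairs `(σ1, σ2)` with `σ1 ≰ σ2`. -/
def LabelFeas {V : Type*} (E : Set (V × V)) {k : ℕ} (s : Fin k → V)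
    (D : Fin k → Fin k → Prop) (x : V × V → ℝ)
    (zv : V → (Fin k → Bool) → ℝ)
    (ze : V × V → (Fin k → Bool) → (Fin k → Bool) → ℝ) : Prop :=
  (∀ v σ, 0 ≤ zv v σ ∧ zv v σ ≤ 1) ∧
  (∀ e ∈ E, ∀ σ1 σ2, 0 ≤ ze e σ1 σ2 ∧ ze e σ1 σ2 ≤ 1) ∧
  (∀ e ∈ E, 0 ≤ x e ∧ x e ≤ 1) ∧
  (∀ v, ∑ σ, zv v σ = 1) ∧
  (∀ i : Fin k, ∀ σ, σ i = false → zv (s i) σ = 0) ∧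
  (∀ i j : Fin k, D i j → ∀ σ, σ i = true → zv (s j) σ = 0) ∧
  (∀ e ∈ E, ∀ σ1, ∑ σ2, ze e σ1 σ2 = zv e.1 σ1) ∧
  (∀ e ∈ E, ∀ σ2, ∑ σ1, ze e σ1 σ2 = zv e.2 σ2) ∧
  (∀ e ∈ E, x e = ∑ σ1 : Fin k → Bool, ∑ σ2 : Fin k → Bool,
      if ¬ (∀ m, σ1 m ≤ σ2 m) then ze e σ1 σ2 else 0)

lemma mc_sInf {A B : Set ℝ} (h : B ⊆ A) (h0 : ∀ a ∈ A, 0 ≤ a) (h2 : ∀ a ∈ A, ∃ b ∈ B, b ≤ a) :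
    sInf A = sInf B := by
  rcases A.eq_empty_or_nonempty with hA | hA
  · subst hA; rw [Set.subset_empty_iff.1 h]
  · have hB : B.Nonempty := by
      obtain ⟨a, ha⟩ := hA
      obtain ⟨b, hb, _⟩ := h2 a ha
      exact ⟨b, hb⟩
    apply le_antisymm
    · exact csInf_le_csInf ⟨0, fun a ha => h0 a ha⟩ hB h
    · apply le_csInf hA
      intro a ha
      obtain ⟨b, hb, hba⟩ := h2 a ha
      exact (csInf_le ⟨0, fun a ha => h0 a (h ha)⟩ hb).trans hba

lemma mc_zip {V : Type*} (x : V × V → ℝ) (v : V) (p : List V) : ∀ a : V,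
    (((a :: (p ++ [v])).zip (p ++ [v])).map x).sum
      = (((a :: p).zip p).map x).sum + x ((a :: p).getLast (List.cons_ne_nil _ _), v) := by
  induction p with
  | nil => intro a; simp
  | cons b p ih =>
    intro a
    have := ih b
    simp only [List.cons_append, List.zip_cons_cons, List.map_cons, List.sum_cons] at this ⊢
    rw [this, List.getLast_cons (List.cons_ne_nil _ _)]
    ring

lemma mc_chain {V : Type*} {E : Set (V × V)} (v : V) (p : List V) : ∀ a : V,
    List.IsChain (fun a b => (a, b) ∈ E) (a :: p) →
    ((a :: p).getLast (List.cons_ne_nil _ _), v) ∈ E →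
    List.IsChain (fun a b => (a, b) ∈ E) (a :: (p ++ [v])) := by
  induction p with
  | nil => intro a h h2; simpa using h2
  | cons b p ih =>
    intro a h h2
    rw [List.isChain_cons_cons] at h
    rw [List.getLast_cons (List.cons_ne_nil _ _)] at h2
    exact List.isChain_cons_cons.2 ⟨h.1, ih b h.2 h2⟩

lemma mc_nonneg {V : Type*} {E : Set (V × V)} (x : V × V → ℝ) (hx : ∀ e ∈ E, 0 ≤ x e)
    (p : List V) : ∀ a : V,
    List.IsChain (fun a b => (a, b) ∈ E) (a :: p) → 0 ≤ (((a :: p).zip p).map x).sum := by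
  induction p with
  | nil => intro a h; simp
  | cons b p ih =>
    intro a h
    rw [List.isChain_cons_cons] at h
    have := ih b h.2
    have := hx _ h.1
    simp only [List.zip_cons_cons, List.map_cons, List.sum_cons]
    linarith

lemma mc_tele {V : Type*} {E : Set (V × V)} (x : V × V → ℝ) (f : V → ℝ)
    (hx : ∀ e ∈ E, f e.1 - f e.2 ≤ x e)
    (p : List V) : ∀ a : V,
    List.IsChain (fun a b => (a, b) ∈ E) (a :: p) →
    f a - f ((a :: p).getLast (List.cons_ne_nil _ _)) ≤ (((a :: p).zip p).map x).sum := by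
  induction p with
  | nil => intro a h; simp
  | cons b p ih =>
    intro a h
    rw [List.isChain_cons_cons] at h
    have := ih b h.2
    have := hx _ h.1
    simp only [List.zip_cons_cons, List.map_cons, List.sum_cons]
    rw [List.getLast_cons (List.cons_ne_nil _ _)]
    simp only at this
    linarith

lemma mc_label_dist {V : Type*} {E : Set (V × V)} {k : ℕ} {s : Fin k → V}
    {D : Fin k → Fin k → Prop} {x : V × V → ℝ} {zv : V → (Fin k → Bool) → ℝ}
    {ze : V × V → (Fin k → Bool) → (Fin k → Bool) → ℝ} (h : LabelFeas E s D x zv ze) :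
    DistFeas E s D x := by
  obtain ⟨h1, h2, h3, h4, h5, h6, h7, h8, h9⟩ := h
  refine ⟨fun e he => (h3 e he).1, ?_⟩
  intro i j hij p hp hl
  set f : V → ℝ := fun v => ∑ σ : Fin k → Bool, if σ i = true then zv v σ else 0 with hf
  have key : ∀ e ∈ E, f e.1 - f e.2 ≤ x e := by
    intro e he
    have e1 : f e.1 = ∑ σ1 : Fin k → Bool, ∑ σ2 : Fin k → Bool,
        if σ1 i = true then ze e σ1 σ2 else 0 := by
      simp only [hf]
      refine Finset.sum_congr rfl fun σ1 _ => ?_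
      split_ifs
      · exact (h7 e he σ1).symm
      · simp
    have e2 : f e.2 = ∑ σ1 : Fin k → Bool, ∑ σ2 : Fin k → Bool,
        if σ2 i = true then ze e σ1 σ2 else 0 := by
      rw [Finset.sum_comm]
      simp only [hf]
      refine Finset.sum_congr rfl fun σ1 _ => ?_
      split_ifs
      · exact (h8 e he σ1).symm
      · simp
    rw [e1, e2, h9 e he, ← Finset.sum_sub_distrib]
    refine Finset.sum_le_sum fun σ1 _ => ?_
    rw [← Finset.sum_sub_distrib]
    refine Finset.sum_le_sum fun σ2 _ => ?_
    have h0 := (h2 e he σ1 σ2).1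
    by_cases hc : ∀ m, σ1 m ≤ σ2 m
    · have := hc i
      rw [Bool.le_iff_imp] at this
      rw [if_neg (not_not.2 hc)]
      by_cases a1 : σ1 i = true
      · rw [if_pos a1, if_pos (this a1)]; linarith
      · rw [if_neg a1]; split_ifs <;> linarith
    · rw [if_pos hc]
      split_ifs <;> linarith
  have t := mc_tele x f key p (s i) hp
  rw [hl] at t
  have f1 : f (s i) = 1 := by
    rw [← h4 (s i)]
    refine Finset.sum_congr rfl fun σ _ => ?_
    split_ifs with hc
    · rfl
    · exact (h5 i σ (by simpa using hc)).symm
  have f2 : f (s j) = 0 := by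
    refine Finset.sum_eq_zero fun σ _ => ?_
    split_ifs with hc
    · exact h6 i j hij σ hc
    · rfl
  linarith

lemma mc_pot {V : Type*} {E : Set (V × V)} {k : ℕ} {s : Fin k → V}
    {D : Fin k → Fin k → Prop} {x : V × V → ℝ} (h : DistFeas E s D x) :
    ∃ d : Fin k → V → ℝ, (∀ i, d i (s i) ≤ 0) ∧ (∀ i j, D i j → 1 ≤ d i (s j)) ∧
      ∀ i, ∀ e ∈ E, d i e.2 ≤ d i e.1 + x e := by
  obtain ⟨h0, h1⟩ := h
  let S : Fin k → V → Set ℝ := fun i v => {l | l = 1 ∨ ∃ p : List V,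
    List.IsChain (fun a b => (a, b) ∈ E) (s i :: p) ∧
    (s i :: p).getLast (List.cons_ne_nil _ _) = v ∧ l = (((s i :: p).zip p).map x).sum}
  have hne : ∀ i v, (S i v).Nonempty := fun i v => ⟨1, Or.inl rfl⟩
  have hb : ∀ i v, BddBelow (S i v) := by
    intro i v
    refine ⟨0, ?_⟩
    rintro l (rfl | ⟨p, hp, _, rfl⟩)
    · norm_num
    · exact mc_nonneg x h0 p _ hp
  refine ⟨fun i v => sInf (S i v), ?_, ?_, ?_⟩
  · intro i
    exact csInf_le (hb _ _) (Or.inr ⟨[], by simp, by simp, by simp⟩)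
  · intro i j hij
    apply le_csInf (hne _ _)
    rintro l (rfl | ⟨p, hp, hl, rfl⟩)
    · exact le_rfl
    · exact h1 i j hij p hp hl
  · intro i e he
    rw [← sub_le_iff_le_add]
    apply le_csInf (hne _ _)
    rintro l (rfl | ⟨p, hp, hl, rfl⟩)
    · have := csInf_le (hb i e.2) (Or.inl rfl)
      have := h0 e he
      linarith
    · rw [sub_le_iff_le_add]
      have he' : ((s i :: p).getLast (List.cons_ne_nil _ _), e.2) ∈ E := by rw [hl]; exact he
      refine csInf_le (hb _ _) (Or.inr ⟨p ++ [e.2], mc_chain e.2 p _ hp he', by simp, ?_⟩)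
      rw [mc_zip, hl]

lemma mc_int {p : ℝ → Prop} [DecidablePred p] (hp : MeasurableSet {t | p t}) (a b : ℝ) :
    IntervalIntegrable (fun t => if p t then (1:ℝ) else 0) MeasureTheory.volume a b := by
  have : (fun t => if p t then (1:ℝ) else 0) = Set.indicator {t | p t} (fun _ => 1) := by
    ext t; simp [Set.indicator]
  rw [this, intervalIntegrable_iff]
  refine MeasureTheory.IntegrableOn.indicator ?_ hp
  simp

lemma mc_int01 {p : ℝ → Prop} [DecidablePred p] (hp : MeasurableSet {t | p t}) {a b : ℝ}
    (hab : a ≤ b) :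
    0 ≤ (∫ t in a..b, if p t then (1:ℝ) else 0) ∧
      (∫ t in a..b, if p t then (1:ℝ) else 0) ≤ b - a := by
  constructor
  · apply intervalIntegral.integral_nonneg hab
    intro t _; split_ifs <;> norm_num
  · calc _ ≤ ∫ t in a..b, (1:ℝ) := by
          apply intervalIntegral.integral_mono_on hab (mc_int hp a b) (by simp)
          intro t _; split_ifs <;> norm_num
      _ = b - a := by simp

lemma mc_dist_label {V : Type*} {E : Set (V × V)} {k : ℕ} {s : Fin k → V}
    {D : Fin k → Fin k → Prop} {x : V × V → ℝ} (h : DistFeas E s D x) :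
    ∃ x' zv ze, LabelFeas E s D x' zv ze ∧ ∀ e ∈ E, x' e ≤ x e := by
  obtain ⟨d, d0, d1, d2⟩ := mc_pot h
  let lab : V → ℝ → Fin k → Bool := fun v t m => decide (d m v ≤ Int.fract t)
  have hlab : ∀ v, Measurable (lab v) := by
    intro v
    refine measurable_pi_lambda _ fun m => ?_
    refine measurable_to_bool ?_
    have : (fun t => lab v t m) ⁻¹' {true} = {t | d m v ≤ Int.fract t} := by
      ext t; simp [lab]
    rw [this]
    exact measurableSet_le measurable_const measurable_fract
  have hper : ∀ v t, lab v (t + 1) = lab v t := by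
    intro v t; simp [lab]
  let c : V × V → ℝ := fun e => min (x e) 1
  have hm2 : ∀ (e : V × V), Measurable
      (fun t => (lab e.1 t, lab e.2 (t + c e))) := fun e =>
    (hlab e.1).prodMk ((hlab e.2).comp (measurable_id.add_const _))
  have m1 : ∀ v σ, MeasurableSet {t | lab v t = σ} := fun v σ =>
    hlab v (measurableSet_singleton σ)
  have m2 : ∀ (e : V × V) (Q : (Fin k → Bool) × (Fin k → Bool) → Prop),
      MeasurableSet {t | Q (lab e.1 t, lab e.2 (t + c e))} := fun e Q =>
    hm2 e (Set.toFinite {q | Q q}).measurableSet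
  let zv : V → (Fin k → Bool) → ℝ := fun v σ => ∫ t in (0:ℝ)..1, if lab v t = σ then 1 else 0
  let ze : V × V → (Fin k → Bool) → (Fin k → Bool) → ℝ := fun e σ1 σ2 =>
    ∫ t in (0:ℝ)..1, if (lab e.1 t = σ1 ∧ lab e.2 (t + c e) = σ2) then 1 else 0
  let x' : V × V → ℝ := fun e =>
    ∫ t in (0:ℝ)..1, if ¬ (∀ m, lab e.1 t m ≤ lab e.2 (t + c e) m) then 1 else 0
  have mz : ∀ e σ1 σ2, MeasurableSet {t | lab e.1 t = σ1 ∧ lab e.2 (t + c e) = σ2} :=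
    fun e σ1 σ2 => m2 e (fun q => q.1 = σ1 ∧ q.2 = σ2)
  have mx : ∀ e, MeasurableSet {t | ¬ (∀ m, lab e.1 t m ≤ lab e.2 (t + c e) m)} :=
    fun e => m2 e (fun q => ¬ (∀ m, q.1 m ≤ q.2 m))
  refine ⟨x', zv, ze, ⟨?_, ?_, ?_, ?_, ?_, ?_, ?_, ?_, ?_⟩, ?_⟩
  · intro v σ
    simpa using mc_int01 (m1 v σ) zero_le_one
  · intro e _ σ1 σ2
    simpa using mc_int01 (mz e σ1 σ2) zero_le_one
  · intro e _
    have := mc_int01 (mx e) (zero_le_one (α := ℝ))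
    rw [sub_zero] at this
    exact this
  · intro v
    simp only [zv]
    rw [← intervalIntegral.integral_finsetSum (fun σ _ => mc_int (m1 v σ) 0 1)]
    simp
  · intro i σ hσ
    simp only [zv]
    refine (intervalIntegral.integral_congr (g := fun _ => (0:ℝ)) fun t _ => ?_).trans (by simp)
    simp only
    rw [if_neg]
    rintro rfl
    have := (d0 i).trans (Int.fract_nonneg t)
    simp [lab] at hσ
    linarith
  · intro i j hij σ hσ
    simp only [zv]
    refine (intervalIntegral.integral_congr (g := fun _ => (0:ℝ)) fun t _ => ?_).trans (by simp)
    simp only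
    rw [if_neg]
    rintro rfl
    have := (Int.fract_lt_one t).trans_le (d1 i j hij)
    simp [lab] at hσ
    linarith
  · intro e _ σ1
    simp only [zv, ze]
    rw [← intervalIntegral.integral_finsetSum (fun σ _ => mc_int (mz e σ1 σ) 0 1)]
    congr 1
    ext t
    simp only [ite_and]
    split_ifs <;> simp
  · intro e _ σ2
    simp only [zv, ze]
    rw [← intervalIntegral.integral_finsetSum (fun σ _ => mc_int (mz e σ σ2) 0 1)]
    have p : Function.Periodic (fun t => if lab e.2 t = σ2 then (1:ℝ) else 0) 1 := by
      intro t; simp only [hper]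
    have q := p.intervalIntegral_add_eq 0 (c e)
    rw [zero_add] at q
    rw [q, add_comm (c e) 1]
    have r := intervalIntegral.integral_comp_add_right (a := 0) (b := 1)
      (fun t => if lab e.2 t = σ2 then (1:ℝ) else 0) (c e)
    rw [zero_add] at r
    rw [← r]
    congr 1
    ext t
    simp only [and_comm, ite_and]
    split_ifs <;> simp
  · intro e _
    have : ∀ σ1 σ2 : Fin k → Bool, (if ¬ (∀ m, σ1 m ≤ σ2 m) then ze e σ1 σ2 else 0)
      = ∫ t in (0:ℝ)..1, if ((lab e.1 t = σ1 ∧ lab e.2 (t + c e) = σ2) ∧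
          ¬ (∀ m, σ1 m ≤ σ2 m)) then (1:ℝ) else 0 := by
      intro σ1 σ2
      by_cases hc : ∀ m, σ1 m ≤ σ2 m
      · simp [hc]
      · simp only [hc, ze, not_false_eq_true, and_true, if_true]
    simp only [this]
    have mm : ∀ σ1 σ2 : Fin k → Bool, MeasurableSet {t | (lab e.1 t = σ1 ∧ lab e.2 (t + c e) = σ2) ∧
          ¬ (∀ m, σ1 m ≤ σ2 m)} := fun σ1 σ2 =>
        m2 e (fun q => (q.1 = σ1 ∧ q.2 = σ2) ∧ ¬ (∀ m, σ1 m ≤ σ2 m))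
    rw [← Finset.sum_product', ← intervalIntegral.integral_finsetSum
      (fun q _ => mc_int (mm q.1 q.2) 0 1)]
    simp only [x']
    congr 1
    ext t
    rw [Finset.sum_eq_single (lab e.1 t, lab e.2 (t + c e))]
    · simp
    · rintro ⟨a, b⟩ _ hab
      rw [if_neg]
      rintro ⟨⟨rfl, rfl⟩, _⟩
      exact hab rfl
    · simp
  · intro e he
    have c0 : 0 ≤ c e := le_min (h.1 e he) zero_le_one
    have c1 : c e ≤ 1 := min_le_right _ _
    refine le_trans ?_ (min_le_left (x e) 1)
    change x' e ≤ c e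
    simp only [x']
    rw [← intervalIntegral.integral_add_adjacent_intervals (b := 1 - c e)
      (mc_int (mx e) _ _) (mc_int (mx e) _ _)]
    have b2 := (mc_int01 (mx e) (a := 1 - c e) (b := 1) (by linarith)).2
    have b1 : (∫ t in (0:ℝ)..(1 - c e),
        if ¬ (∀ m, lab e.1 t m ≤ lab e.2 (t + c e) m) then (1:ℝ) else 0) = 0 := by
      rw [intervalIntegral.integral_of_le (by linarith), MeasureTheory.integral_Ioc_eq_integral_Ioo]
      apply MeasureTheory.setIntegral_eq_zero_of_forall_eq_zero
      rintro t ⟨t0, t1⟩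
      rw [if_neg]
      rw [not_not]
      intro m
      have f1 : Int.fract t = t := Int.fract_eq_self.2 ⟨t0.le, by linarith⟩
      have f2 : Int.fract (t + c e) = t + c e := Int.fract_eq_self.2 ⟨by linarith, by linarith⟩
      simp only [lab, f1, f2]
      rw [Bool.le_iff_imp]
      simp only [decide_eq_true_eq]
      intro hh
      have hx : c e = x e := by
        apply min_eq_left
        by_contra hc
        have : c e = 1 := min_eq_right (by linarith)
        linarith
      have := d2 m e he
      linarith
    rw [b1]
    linarith

lemma mc_dist_label_bin {V : Type*} {E : Set (V × V)} {k : ℕ} {s : Fin k → V}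
    {D : Fin k → Fin k → Prop} {x : V × V → ℝ} (h : DistFeas E s D x)
    (hbin : ∀ e ∈ E, x e = 0 ∨ x e = 1) :
    ∃ x' zv ze, LabelFeas E s D x' zv ze ∧ (∀ e ∈ E, x' e = 0 ∨ x' e = 1) ∧
      (∀ v σ, zv v σ = 0 ∨ zv v σ = 1) ∧
      (∀ e ∈ E, ∀ σ1 σ2, ze e σ1 σ2 = 0 ∨ ze e σ1 σ2 = 1) ∧ ∀ e ∈ E, x' e ≤ x e := by
  obtain ⟨d, d0, d1, d2⟩ := mc_pot h
  let lab : V → Fin k → Bool := fun v m => decide (d m v < 1)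
  have hb : ∀ (p : Prop) [Decidable p], 0 ≤ (if p then (1:ℝ) else 0) ∧
      (if p then (1:ℝ) else 0) ≤ 1 := by intro p _; split_ifs <;> norm_num
  have hb' : ∀ (p : Prop) [Decidable p], (if p then (1:ℝ) else 0) = 0 ∨
      (if p then (1:ℝ) else 0) = 1 := by intro p _; split_ifs <;> norm_num
  refine ⟨fun e => if ¬ (∀ m, lab e.1 m ≤ lab e.2 m) then 1 else 0,
    fun v σ => if lab v = σ then 1 else 0,
    fun e σ1 σ2 => if lab e.1 = σ1 ∧ lab e.2 = σ2 then 1 else 0,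
    ⟨fun v σ => hb _, fun e _ σ1 σ2 => hb _, fun e _ => hb _, ?_, ?_, ?_, ?_, ?_, ?_⟩,
    fun e _ => hb' _, fun v σ => hb' _, fun e _ σ1 σ2 => hb' _, ?_⟩
  · intro v; simp
  · intro i σ hσ
    simp only
    rw [if_neg]
    rintro rfl
    have := d0 i
    simp [lab] at hσ
    linarith
  · intro i j hij σ hσ
    simp only
    rw [if_neg]
    rintro rfl
    have := d1 i j hij
    simp [lab] at hσ
    linarith
  · intro e _ σ1
    simp only [ite_and]
    split_ifs <;> simp
  · intro e _ σ2
    simp only [and_comm, ite_and]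
    split_ifs <;> simp
  · intro e _
    rw [Finset.sum_eq_single (lab e.1), Finset.sum_eq_single (lab e.2)]
    · simp
    · intro b _ hb
      simp [hb.symm]
    · simp
    · intro b _ hb
      simp [hb.symm]
    · simp
  · intro e he
    simp only
    rcases hbin e he with h0 | h1
    · rw [if_neg, h0]
      rw [not_not]
      intro m
      rw [Bool.le_iff_imp]
      simp only [lab, decide_eq_true_eq]
      intro hh
      have := d2 m e he
      linarith
    · rw [h1]; exact (hb _).2

/-- For a finite directed supply graph `G = (V, E)` with nonnegative
weights `w`, terminals `s 1, …, s k`, and demand graph `D`, the optimum of the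
Distance-LP equals the optimum of the Label-LP, and the optima over binary (`{0,1}`-
valued) solutions also agree.  Concretely, every feasible Label-LP solution
`(x, zv, ze)` yields the same `x` as a feasible Distance-LP solution with the same
cost, and every feasible Distance-LP solution `x` admits a feasible Label-LP solution
`(x', zv, ze)` with `x' e ≤ x e` on every edge, hence of cost at most that of `x`. -/
theorem stmt_8 {V : Type*} [Fintype V] (E : Finset (V × V))
    (w : V × V → ℝ) (hw : ∀ e ∈ E, 0 ≤ w e)
    (k : ℕ) (s : Fin k → V) (D : Fin k → Fin k → Prop) :
    (sInf {c : ℝ | ∃ x, DistFeas (↑E : Set (V × V)) s D x ∧ c = ∑ e ∈ E, w e * x e}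
      = sInf {c : ℝ | ∃ x zv ze, LabelFeas (↑E : Set (V × V)) s D x zv ze ∧
          c = ∑ e ∈ E, w e * x e}) ∧
    (sInf {c : ℝ | ∃ x, DistFeas (↑E : Set (V × V)) s D x ∧
          (∀ e ∈ E, x e = 0 ∨ x e = 1) ∧ c = ∑ e ∈ E, w e * x e}
      = sInf {c : ℝ | ∃ x zv ze, LabelFeas (↑E : Set (V × V)) s D x zv ze ∧
          (∀ e ∈ E, x e = 0 ∨ x e = 1) ∧
          (∀ v σ, zv v σ = 0 ∨ zv v σ = 1) ∧
          (∀ e ∈ E, ∀ σ1 σ2, ze e σ1 σ2 = 0 ∨ ze e σ1 σ2 = 1) ∧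
          c = ∑ e ∈ E, w e * x e}) ∧
    (∀ x zv ze, LabelFeas (↑E : Set (V × V)) s D x zv ze →
      DistFeas (↑E : Set (V × V)) s D x) ∧
    (∀ x, DistFeas (↑E : Set (V × V)) s D x →
      ∃ x' zv ze, LabelFeas (↑E : Set (V × V)) s D x' zv ze ∧
        ∀ e ∈ E, x' e ≤ x e) := by
  have nn : ∀ x, DistFeas (↑E : Set (V × V)) s D x → 0 ≤ ∑ e ∈ E, w e * x e := fun x hx =>
    Finset.sum_nonneg fun e he => mul_nonneg (hw e he) (hx.1 e he)
  have mono : ∀ x x' : V × V → ℝ, (∀ e ∈ E, x' e ≤ x e) →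
      ∑ e ∈ E, w e * x' e ≤ ∑ e ∈ E, w e * x e := fun x x' h =>
    Finset.sum_le_sum fun e he => mul_le_mul_of_nonneg_left (h e he) (hw e he)
  refine ⟨mc_sInf ?_ ?_ ?_, mc_sInf ?_ ?_ ?_, fun x zv ze h => mc_label_dist h,
    fun x h => mc_dist_label h⟩
  · rintro c ⟨x, zv, ze, h, rfl⟩
    exact ⟨x, mc_label_dist h, rfl⟩
  · rintro c ⟨x, h, rfl⟩
    exact nn x h
  · rintro c ⟨x, h, rfl⟩
    obtain ⟨x', zv, ze, h', hle⟩ := mc_dist_label h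
    exact ⟨_, ⟨x', zv, ze, h', rfl⟩, mono x x' hle⟩
  · rintro c ⟨x, zv, ze, h, hb, _, _, rfl⟩
    exact ⟨x, mc_label_dist h, hb, rfl⟩
  · rintro c ⟨x, h, _, rfl⟩
    exact nn x h
  · rintro c ⟨x, h, hb, rfl⟩
    obtain ⟨x', zv, ze, h', b1, b2, b3, hle⟩ := mc_dist_label_bin h hb
    exact ⟨_, ⟨x', zv, ze, h', b1, b2, b3, rfl⟩, mono x x' hle⟩
end

section
/- Let G=(V,E) be a directed supply graph with feasible edge lengths x:E→ℝ≥0 for a directed demand graph H=(V,F) (i.e., the shortest-path distance satisfies d(u,v) ≥ 1 for every (u,v)∈F), and let d_1 be defined from d as usual. If for some vertex v∈V there exist vertices u_1,…,u_k such that the values d_1(u_1,v),…,d_1(u_k,v) are nonzero and pairwise distinct, then the demand graph H contains an induced k-matching-extension. -/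
/-- `dOne F d u v = max 0 (1 − min_{v' : (u,v') ∈ F} d v v')`, the quantity `d₁(u,v)`
of the rounding scheme; it is `0` when `u` has no outgoing demand edge in `F`. -/
noncomputable def dOne {V : Type*} [DecidableEq V] (F : Finset (V × V))
    (d : V → V → ℝ) (u v : V) : ℝ :=
  if h : (F.filter fun e => e.1 = u).Nonempty then
    max 0 (1 - (F.filter fun e => e.1 = u).inf' h fun e => d v e.2)
  else 0

/-- A directed graph with edge set `F` contains an induced `k`-matching-extension if
there are vertices `s 1, …, s k` (pairwise distinct) and `t 1, …, t k` (pairwise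
distinct; an `s i` may coincide with a `t j`) such that `(s i, t i) ∈ F` for every `i`
and `(s i, t j) ∉ F` whenever `i > j`. -/
def HasKMatchingExtension {V : Type*} (F : Set (V × V)) (k : ℕ) : Prop :=
  ∃ s t : Fin k → V, Function.Injective s ∧ Function.Injective t ∧
    (∀ i, (s i, t i) ∈ F) ∧ ∀ i j : Fin k, j < i → (s i, t j) ∉ F

/-- `G = (V, E)` is a directed supply graph with lengths `x ≥ 0`, `F`
the demand edge set, `d` the shortest-path distance under `x` (so `d u u = 0`, `d ≥ 0`,
`d` satisfies the triangle inequality and `d a w ≤ x (a,b) + d b w` for `(a,b) ∈ E`),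
`x` feasible (`d u v ≥ 1` for every `(u,v) ∈ F`), and `d₁ = dOne F d`.  If for some
vertex `v` there are vertices `u 1, …, u k` whose values `d₁(u i, v)` are nonzero and
pairwise distinct, then `F` contains an induced `k`-matching-extension. -/
theorem stmt_10 {V : Type*} [DecidableEq V]
    (E : Set (V × V)) (x : V × V → ℝ) (hx : ∀ e ∈ E, 0 ≤ x e)
    (F : Finset (V × V)) (d : V → V → ℝ)
    (hd0 : ∀ u, d u u = 0)
    (hdnn : ∀ u v, 0 ≤ d u v)
    (hdtri : ∀ u v w, d u w ≤ d u v + d v w)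
    (hdedge : ∀ a b, (a, b) ∈ E → ∀ w, d a w ≤ x (a, b) + d b w)
    (hfeas : ∀ e ∈ F, 1 ≤ d e.1 e.2)
    (k : ℕ) (v : V) (u : Fin k → V)
    (hne : ∀ i, dOne F d (u i) v ≠ 0)
    (hdist : ∀ i j, i ≠ j → dOne F d (u i) v ≠ dOne F d (u j) v) :
    HasKMatchingExtension (↑F : Set (V × V)) k := by
  have key : ∀ i, ∃ t, (u i, t) ∈ F ∧ dOne F d (u i) v = 1 - d v t ∧
      ∀ w, (u i, w) ∈ F → d v t ≤ d v w := by
    intro i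
    have hi := hne i
    unfold dOne at hi ⊢
    split_ifs at hi ⊢ with h
    · obtain ⟨e, he, heq⟩ := Finset.exists_mem_eq_inf' h (fun e : V × V => d v e.2)
      have hmem := Finset.mem_filter.1 he
      refine ⟨e.2, ?_, ?_, ?_⟩
      · rw [← hmem.2]; exact hmem.1
      · rw [← heq]
        rcases max_choice (0 : ℝ)
          (1 - (F.filter fun e => e.1 = u i).inf' h fun e => d v e.2) with h0 | h0
        · exact absurd h0 hi
        · exact h0
      · intro w hw
        rw [← heq]
        exact Finset.inf'_le (fun e : V × V => d v e.2)
          (Finset.mem_filter.2 ⟨hw, rfl⟩ : (u i, w) ∈ F.filter fun e => e.1 = u i)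
    · exact absurd rfl hi
  choose t ht hD hmin using key
  let m : Fin k → ℝ := fun i => d v (t i)
  have hm : Function.Injective m := by
    intro i j hij
    by_contra hne'
    apply hdist i j hne'
    rw [hD i, hD j]
    have : d v (t i) = d v (t j) := hij
    rw [this]
  have hinj : Function.Injective (m ∘ Tuple.sort m) := hm.comp (Tuple.sort m).injective
  have hmono : StrictMono (m ∘ Tuple.sort m) := (Tuple.monotone_sort m).strictMono_of_injective hinj
  refine ⟨fun i => u (Tuple.sort m i), fun i => t (Tuple.sort m i), ?_, ?_, ?_, ?_⟩
  · intro i j hij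
    apply (Tuple.sort m).injective
    by_contra hne'
    exact hdist _ _ hne' (congrArg (fun z => dOne F d z v) hij)
  · intro i j hij
    exact hinj (congrArg (d v) hij)
  · intro i
    exact ht _
  · intro i j hji hmem
    exact absurd (hmin _ _ hmem) (not_le.2 (hmono hji))
end

section
/- Let G=(V,E) be a directed supply graph with feasible edge lengths x:E→ℝ≥0 for a directed demand graph H=(V,F) (shortest-path distance d(u,v) ≥ 1 for every (u,v)∈F), and let d_1 be defined from d as usual. For any θ ∈ (0,1), the edge set E' = {(a,b)∈E : there exists u∈V with d_1(u,a) ≤ θ < d_1(u,b)} is a feasible multicut for (G,H): for every (u,v)∈F there is no directed path from u to v in G−E'. -/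
/-- Feasibility of the ball-cut rounding.  `G = (V, E)` is a directed
supply graph with lengths `x ≥ 0`, `F` the demand edge set, `d` the shortest-path
distance under `x` (so `d u u = 0`, `d ≥ 0`, triangle inequality, and
`d a w ≤ x (a,b) + d b w` for `(a,b) ∈ E`), `x` feasible (`d u v ≥ 1` for all
`(u,v) ∈ F`), and `d₁ = dOne F d`.  For any `θ ∈ (0,1)`, the edge set
`E' = {(a,b) ∈ E : ∃ u, d₁(u,a) ≤ θ < d₁(u,b)}` is a feasible multicut: for every
demand `(s,t) ∈ F` there is no directed path from `s` to `t` using only edges of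
`E \ E'`. -/
theorem stmt_11 {V : Type*} [DecidableEq V]
    (E : Set (V × V)) (x : V × V → ℝ) (hx : ∀ e ∈ E, 0 ≤ x e)
    (F : Finset (V × V)) (d : V → V → ℝ)
    (hd0 : ∀ u, d u u = 0)
    (hdnn : ∀ u v, 0 ≤ d u v)
    (hdtri : ∀ u v w, d u w ≤ d u v + d v w)
    (hdedge : ∀ a b, (a, b) ∈ E → ∀ w, d a w ≤ x (a, b) + d b w)
    (hfeas : ∀ e ∈ F, 1 ≤ d e.1 e.2)
    (θ : ℝ) (hθ : θ ∈ Set.Ioo (0 : ℝ) 1) :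
    ∀ st ∈ F, ¬ Relation.ReflTransGen
        (fun a b => (a, b) ∈ E ∧
          ¬ ∃ u : V, dOne F d u a ≤ θ ∧ θ < dOne F d u b)
        st.1 st.2 := by
  intro st hst hpath
  have hmem : st ∈ F.filter fun e => e.1 = st.1 := Finset.mem_filter.mpr ⟨hst, rfl⟩
  have hne : (F.filter fun e => e.1 = st.1).Nonempty :=
    ⟨st, Finset.mem_filter.mpr ⟨hst, rfl⟩⟩
  have key : ∀ b, Relation.ReflTransGen
        (fun a b => (a, b) ∈ E ∧
          ¬ ∃ u : V, dOne F d u a ≤ θ ∧ θ < dOne F d u b)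
        st.1 b → dOne F d st.1 b ≤ θ := by
    intro b hb
    induction hb with
    | refl =>
      rw [dOne, dif_pos hne]
      refine max_le hθ.1.le ?_
      have h1 : 1 ≤ (F.filter fun e => e.1 = st.1).inf' hne fun e => d st.1 e.2 := by
        refine Finset.le_inf' _ _ fun e he => ?_
        have he2 := Finset.mem_filter.mp he
        have := hfeas e he2.1
        rwa [he2.2] at this
      linarith [hθ.1]
    | tail _ hstep ih =>
      by_contra hlt
      exact hstep.2 ⟨st.1, ih, not_le.mp hlt⟩
  have hle := key st.2 hpath
  rw [dOne, dif_pos hne] at hle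
  have h2 := (le_max_right _ _).trans hle
  have h3 : ((F.filter fun e => e.1 = st.1).inf' hne fun e => d st.2 e.2) ≤ d st.2 st.2 :=
    Finset.inf'_le (fun e : V × V => d st.2 e.2) hmem
  rw [hd0] at h3
  linarith [hθ.2]
end

section
/- Let G=(V,E) be a directed supply graph with feasible edge lengths x:E→ℝ≥0 for a directed demand graph H=(V,F), let d_1 be defined from the shortest-path distance d as usual, and suppose H does not contain an induced k-matching-extension. Then for every edge e=(a,b)∈E, the Lebesgue measure of the set {θ ∈ (0,1) : there exists u∈V with d_1(u,a) ≤ θ < d_1(u,b)} is at most (k−1)·x_{(a,b)}. -/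
theorem dOne_ge {V : Type*} [DecidableEq V] (F : Finset (V × V))
    (d : V → V → ℝ) (u v t : V) (h : (u, t) ∈ F) : 1 - d v t ≤ dOne F d u v := by
  have hm : (u, t) ∈ F.filter fun e => e.1 = u := by simp [h]
  unfold dOne
  rw [dif_pos ⟨_, hm⟩]
  apply le_max_of_le_right
  have := Finset.inf'_le (fun e : V × V => d v e.2) hm
  simp only at this
  linarith

theorem dOne_pos_ex {V : Type*} [DecidableEq V] (F : Finset (V × V))
    (d : V → V → ℝ) (u v : V) (h : 0 < dOne F d u v) :
    ∃ t, (u, t) ∈ F ∧ dOne F d u v = 1 - d v t := by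
  unfold dOne at h ⊢
  split_ifs at h ⊢ with hne
  · obtain ⟨e, he, heq⟩ := Finset.exists_mem_eq_inf' hne (fun e : V × V => d v e.2)
    rw [Finset.mem_filter] at he
    obtain ⟨e1, e2⟩ := e
    obtain ⟨he, rfl⟩ := he
    refine ⟨e2, he, ?_⟩
    rw [heq] at h ⊢
    rcases lt_max_iff.1 h with h | h
    · exact absurd h (lt_irrefl _)
    · exact max_eq_right h.le
  · exact absurd h (lt_irrefl _)

/-- Per-edge cutting probability bound.  `G = (V, E)` is a finite
directed supply graph with lengths `x ≥ 0`, `F` the demand edge set, `d` the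
shortest-path distance under `x` (so `d u u = 0`, `d ≥ 0`, triangle inequality, and
`d a w ≤ x (a,b) + d b w` for `(a,b) ∈ E`), `x` feasible (`d u v ≥ 1` for all
`(u,v) ∈ F`), and `d₁ = dOne F d`.  If `F` contains no induced
`k`-matching-extension, then for every edge `(a,b) ∈ E` the Lebesgue measure of
`{θ ∈ (0,1) : ∃ u, d₁(u,a) ≤ θ < d₁(u,b)}` is at most `(k−1) · x (a,b)`. -/
theorem stmt_12 {V : Type*} [Fintype V] [DecidableEq V]
    (E : Set (V × V)) (x : V × V → ℝ) (hx : ∀ e ∈ E, 0 ≤ x e)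
    (F : Finset (V × V)) (d : V → V → ℝ)
    (hd0 : ∀ u, d u u = 0)
    (hdnn : ∀ u v, 0 ≤ d u v)
    (hdtri : ∀ u v w, d u w ≤ d u v + d v w)
    (hdedge : ∀ a b, (a, b) ∈ E → ∀ w, d a w ≤ x (a, b) + d b w)
    (hfeas : ∀ e ∈ F, 1 ≤ d e.1 e.2)
    (k : ℕ) (hH : ¬ HasKMatchingExtension (↑F : Set (V × V)) k)
    (a b : V) (hab : (a, b) ∈ E) :
    MeasureTheory.volume
        {θ : ℝ | θ ∈ Set.Ioo (0 : ℝ) 1 ∧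
          ∃ u : V, dOne F d u a ≤ θ ∧ θ < dOne F d u b}
      ≤ ENNReal.ofReal (((k : ℝ) - 1) * x (a, b)) := by
  classical
  set R : Finset ℝ := (Finset.univ.image fun u => dOne F d u b).filter fun r => 0 < r with hR
  have hcard : R.card < k := by
    by_contra hk
    push Not at hk
    obtain ⟨R', hR', hc⟩ := Finset.exists_subset_card_eq hk
    have key : ∀ r ∈ R, ∃ u t, (u, t) ∈ F ∧ dOne F d u b = r ∧ r = 1 - d b t := by
      intro r hr
      simp only [hR, Finset.mem_filter, Finset.mem_image, Finset.mem_univ, true_and] at hr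
      obtain ⟨⟨u, rfl⟩, hp⟩ := hr
      obtain ⟨t, ht, he⟩ := dOne_pos_ex F d u b hp
      exact ⟨u, t, ht, rfl, he⟩
    let f : Fin k → ℝ := fun i => R'.orderEmbOfFin hc i.rev
    have hf : ∀ i j, j < i → f i < f j := by
      intro i j hij
      exact (R'.orderEmbOfFin hc).strictMono (Fin.rev_lt_rev.2 hij)
    have hfi : Function.Injective f := fun i j h => by
      rcases lt_trichotomy i j with h' | h' | h'
      · exact absurd h (hf _ _ h').ne'
      · exact h'
      · exact absurd h (hf _ _ h').ne
    choose s t h1 h2 h3 using fun i => key (f i) (hR' (R'.orderEmbOfFin_mem hc i.rev))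
    refine hH ⟨s, t, ?_, ?_, fun i => h1 i, ?_⟩
    · intro i j h
      apply hfi
      rw [← h2 i, ← h2 j, h]
    · intro i j h
      apply hfi
      rw [h3 i, h3 j, h]
    · intro i j hij hmem
      have := dOne_ge F d (s i) b (t j) hmem
      rw [h2 i, ← h3 j] at this
      exact absurd this (not_le.2 (hf i j hij))
  have hx0 := hx _ hab
  have hsub : {θ : ℝ | θ ∈ Set.Ioo (0 : ℝ) 1 ∧
          ∃ u : V, dOne F d u a ≤ θ ∧ θ < dOne F d u b} ⊆
      ⋃ r ∈ R, Set.Ico (r - x (a, b)) r := by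
    rintro θ ⟨⟨h0, -⟩, u, hl, hr⟩
    have hp : 0 < dOne F d u b := h0.trans hr
    obtain ⟨t, ht, he⟩ := dOne_pos_ex F d u b hp
    have h1 := dOne_ge F d u a t ht
    have h2 := hdedge a b hab t
    refine Set.mem_biUnion (x := dOne F d u b) ?_ ⟨by linarith, hr⟩
    simp [hR, hp]
  refine (MeasureTheory.measure_mono hsub).trans
    ((MeasureTheory.measure_biUnion_finset_le _ _).trans ?_)
  simp only [Real.volume_Ico, sub_sub_cancel, Finset.sum_const, nsmul_eq_mul]
  rw [← ENNReal.ofReal_natCast, ← ENNReal.ofReal_mul (Nat.cast_nonneg _)]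
  apply ENNReal.ofReal_le_ofReal
  apply mul_le_mul_of_nonneg_right _ hx0
  have : (R.card : ℝ) + 1 ≤ k := by exact_mod_cast hcard
  linarith
end

section
/- Let G=(V,E) be a directed supply graph with nonnegative edge weights w:E→ℝ≥0 and let H=(V,F) be a directed demand graph that does not contain an induced k-matching-extension. Then for every feasible fractional solution x:E→ℝ≥0 of the Distance-LP for (G,H), there exists a feasible multicut E'⊆E with Σ_{e∈E'} w_e ≤ (k−1)·Σ_{e∈E} w_e x_e. In particular, the flow-cut gap (integrality gap of the Distance-LP) for such instances is at most k−1. -/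
theorem aux_T {V : Type*} [Fintype V] [DecidableEq V] (F : Finset (V × V)) (k : ℕ)
    (hH : ¬ HasKMatchingExtension (↑F : Set (V × V)) k) (P : V → Prop) (d : V → ℝ) :
    ∃ T : Finset ℝ, (T.card : ℝ) ≤ (k : ℝ) - 1 ∧ ∀ s t, (s, t) ∈ F → P s →
      ∃ c ∈ T, c ≤ d s ∧ ∃ s', (s', t) ∈ F ∧ P s' ∧ d s' = c := by
  classical
  have h1 : ∀ t : V, ∃ s0 : V, (∃ s, (s, t) ∈ F ∧ P s) →
      ((s0, t) ∈ F ∧ P s0 ∧ ∀ s, (s, t) ∈ F → P s → d s0 ≤ d s) := by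
    intro t
    by_cases h : ∃ s, (s, t) ∈ F ∧ P s
    · obtain ⟨s, hs⟩ := h
      obtain ⟨s0, h0, hmin⟩ := Finset.exists_min_image
        (Finset.univ.filter fun s => (s, t) ∈ F ∧ P s) d ⟨s, by simpa using hs⟩
      simp only [Finset.mem_filter, Finset.mem_univ, true_and] at h0 hmin
      exact ⟨s0, fun _ => ⟨h0.1, h0.2, fun s h1 h2 => hmin s ⟨h1, h2⟩⟩⟩
    · exact ⟨t, fun h' => absurd h' h⟩
  choose m hm using h1
  set A := Finset.univ.filter fun t : V => ∃ s, (s, t) ∈ F ∧ P s with hA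
  set T := A.image fun t => d (m t) with hT
  refine ⟨T, ?_, ?_⟩
  · have : T.card < k := by
      by_contra hk
      push Not at hk
      obtain ⟨T', hT', hcard⟩ := Finset.exists_subset_card_eq hk
      apply hH
      let o := T'.orderEmbOfFin hcard
      have h2 : ∀ i : Fin k, ∃ t, (∃ s, (s, t) ∈ F ∧ P s) ∧ d (m t) = o i.rev := by
        intro i
        have := hT' (T'.orderEmbOfFin_mem hcard i.rev)
        simpa [hT, hA] using this
      choose t ht hdt using h2
      have hF : ∀ i j, j < i → (m (t i), t j) ∉ F := by
        intro i j hji hmem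
        have h3 := (hm (t j) (ht j)).2.2 _ hmem (hm (t i) (ht i)).2.1
        rw [hdt, hdt] at h3
        have := o.le_iff_le.1 h3
        rw [Fin.rev_le_rev] at this
        exact absurd hji (not_lt.2 this)
      have hinj : Function.Injective fun i => d (m (t i)) := by
        intro i j hij
        simp only [hdt] at hij
        exact Fin.rev_injective (o.injective hij)
      refine ⟨fun i => m (t i), t, ?_, ?_, fun i => (hm _ (ht i)).1, hF⟩
      · intro i j hij
        exact hinj (congrArg d hij)
      · intro i j hij
        exact hinj (congrArg (fun v => d (m v)) hij)
    have : (T.card : ℝ) + 1 ≤ k := by exact_mod_cast this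
    linarith
  · intro s t hst hP
    have h := hm t ⟨s, hst, hP⟩
    refine ⟨d (m t), ?_, h.2.2 s hst hP, m t, h.1, h.2.1, rfl⟩
    exact Finset.mem_image.2 ⟨t, by simpa [hA] using ⟨s, hst, hP⟩, rfl⟩

def lenSet {V : Type*} (E : Finset (V × V)) (x : V × V → ℝ) (s v : V) : Set ℝ :=
  {l | ∃ p : List V, List.IsChain (fun a b => (a, b) ∈ E) (s :: p) ∧
    (s :: p).getLast (List.cons_ne_nil _ _) = v ∧ l = (((s :: p).zip p).map x).sum}

theorem lenSet_cons {V : Type*} (E : Finset (V × V)) (x : V × V → ℝ) {s u v : V} {l : ℝ}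
    (h : (s, u) ∈ E) (hl : l ∈ lenSet E x u v) : x (s, u) + l ∈ lenSet E x s v := by
  obtain ⟨p, h1, h2, h3⟩ := hl
  refine ⟨u :: p, ?_, ?_, ?_⟩
  · exact List.isChain_cons_cons.2 ⟨h, h1⟩
  · rw [List.getLast_cons (List.cons_ne_nil _ _)]; exact h2
  · simp [h3]

theorem lenSet_self {V : Type*} (E : Finset (V × V)) (x : V × V → ℝ) (s : V) :
    0 ∈ lenSet E x s s := ⟨[], by simp, by simp, by simp⟩

theorem lenSet_snoc {V : Type*} (E : Finset (V × V)) (x : V × V → ℝ) {s a b : V} {l : ℝ}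
    (h : (a, b) ∈ E) (hl : l ∈ lenSet E x s a) : l + x (a, b) ∈ lenSet E x s b := by
  obtain ⟨p, h1, h2, h3⟩ := hl
  induction p generalizing s l with
  | nil =>
    simp at h2 h3
    subst h2; subst h3
    simpa [add_comm] using lenSet_cons E x h (lenSet_self E x b)
  | cons u p ih =>
    rw [List.isChain_cons_cons] at h1
    rw [List.getLast_cons (List.cons_ne_nil _ _)] at h2
    have := lenSet_cons E x h1.1 (ih h1.2 h2 rfl)
    simp at h3
    rw [h3, add_assoc]
    exact this

theorem lenSet_nonneg {V : Type*} (E : Finset (V × V)) (x : V × V → ℝ)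
    (hx0 : ∀ e ∈ E, 0 ≤ x e) {s a : V} {l : ℝ}
    (hl : l ∈ lenSet E x s a) : 0 ≤ l := by
  obtain ⟨p, h1, h2, h3⟩ := hl
  clear h2
  induction p generalizing s l with
  | nil => simp [h3]
  | cons u p ih =>
    rw [List.isChain_cons_cons] at h1
    have := ih h1.2 rfl
    have := hx0 _ h1.1
    simp at h3
    simp at *
    linarith

open MeasureTheory in
theorem aux_avg {ι : Type*} (E : Finset ι) (w x : ι → ℝ) (T : ι → Finset ℝ) (K : ℝ)
    (hw : ∀ e ∈ E, 0 ≤ w e) (hx : ∀ e ∈ E, 0 ≤ x e) (hT : ∀ e ∈ E, ((T e).card : ℝ) ≤ K) :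
    ∃ θ : ℝ, 0 ≤ θ ∧ θ < 1 ∧
      ∑ e ∈ E, w e * ∑ c ∈ T e, (Set.Icc c (c + x e)).indicator (fun _ => (1 : ℝ)) θ
        ≤ K * ∑ e ∈ E, w e * x e := by
  set μ := (volume : Measure ℝ).restrict (Set.Ico 0 1) with hμ
  have hi : ∀ c y : ℝ, Integrable ((Set.Icc c (c + y)).indicator (fun _ => (1 : ℝ))) μ := by
    intro c y
    exact ((integrable_indicator_iff measurableSet_Icc).2 (by simp)).restrict
  have hint : Integrable (fun θ => ∑ e ∈ E, w e * ∑ c ∈ T e,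
      (Set.Icc c (c + x e)).indicator (fun _ => (1 : ℝ)) θ) μ :=
    integrable_finsetSum _ fun e _ => (integrable_finsetSum _ fun c _ => hi c _).const_mul _
  have hval : ∀ c y : ℝ, 0 ≤ y → ∫ θ, (Set.Icc c (c + y)).indicator (fun _ => (1 : ℝ)) θ ∂μ ≤ y := by
    intro c y hy
    have h1 : ∫ θ, (Set.Icc c (c + y)).indicator (fun _ => (1 : ℝ)) θ ∂μ ≤
        ∫ θ, (Set.Icc c (c + y)).indicator (fun _ => (1 : ℝ)) θ := by
      apply setIntegral_le_integral
      · exact (integrable_indicator_iff measurableSet_Icc).2 (by simp)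
      · exact Filter.Eventually.of_forall fun θ => Set.indicator_nonneg (fun _ _ => zero_le_one) θ
    refine h1.trans ?_
    rw [integral_indicator measurableSet_Icc]
    simp [hy]
  obtain ⟨θ, hθ, hle⟩ := exists_le_setAverage (μ := (volume : Measure ℝ)) (s := Set.Ico 0 1)
    (by simp) (by simp) hint
  refine ⟨θ, hθ.1, hθ.2, hle.trans ?_⟩
  rw [setAverage_eq]
  simp only [Real.volume_real_Ico, sub_zero, zero_le_one, sup_of_le_left, inv_one, one_smul]
  rw [integral_finsetSum _ fun e _ => (integrable_finsetSum _ fun c _ => hi c _).const_mul _,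
    Finset.mul_sum]
  apply Finset.sum_le_sum
  intro e he
  rw [integral_const_mul, integral_finsetSum _ fun c _ => hi c _]
  have h2 : ∑ c ∈ T e, ∫ θ, (Set.Icc c (c + x e)).indicator (fun _ => (1 : ℝ)) θ ∂μ ≤ K * x e := by
    refine (Finset.sum_le_card_nsmul _ _ (x e) fun c _ => hval c _ (hx e he)).trans ?_
    rw [nsmul_eq_mul]
    exact mul_le_mul_of_nonneg_right (hT e he) (hx e he)
  calc _ ≤ w e * (K * x e) := mul_le_mul_of_nonneg_left h2 (hw e he)
    _ = _ := by ring

/-- Rounding theorem for directed Multicut.  `G = (V, E)` is a finite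
directed supply graph with nonnegative edge weights `w`, and `F` is a demand graph
containing no induced `k`-matching-extension.  If `x ≥ 0` is feasible for the
Distance-LP — i.e. every directed path (encoded as a vertex list `st.1 :: p` forming a
chain of edges of `E`) from the tail to the head of a demand edge has total `x`-length
at least `1` — then there is a feasible multicut `E' ⊆ E` (no demand pair is joined by
a directed path in `G − E'`) of weight at most `(k−1) · Σ_{e ∈ E} w e * x e`.
In particular the flow-cut gap of such instances is at most `k − 1`. -/
theorem stmt_13 {V : Type*} [Fintype V] [DecidableEq V]
    (E : Finset (V × V)) (w : V × V → ℝ) (hw : ∀ e ∈ E, 0 ≤ w e)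
    (F : Finset (V × V)) (k : ℕ)
    (hH : ¬ HasKMatchingExtension (↑F : Set (V × V)) k)
    (x : V × V → ℝ) (hx0 : ∀ e ∈ E, 0 ≤ x e)
    (hxfeas : ∀ st ∈ F, ∀ p : List V,
      List.Chain' (fun a b => (a, b) ∈ E) (st.1 :: p) →
      (st.1 :: p).getLast (List.cons_ne_nil _ _) = st.2 →
      1 ≤ (((st.1 :: p).zip p).map x).sum) :
    ∃ E' ⊆ E,
      (∀ st ∈ F, ¬ Relation.ReflTransGen
          (fun a b => (a, b) ∈ E ∧ (a, b) ∉ E') st.1 st.2) ∧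
      ∑ e ∈ E', w e ≤ ((k : ℝ) - 1) * ∑ e ∈ E, w e * x e := by
  classical
  set L := lenSet E x with hL
  have hbdd : ∀ s v, BddBelow (L s v) := fun s v => ⟨0, fun l hl => lenSet_nonneg E x hx0 hl⟩
  have hstep : ∀ s a b, (a, b) ∈ E → (L s a).Nonempty →
      (L s b).Nonempty ∧ sInf (L s b) ≤ sInf (L s a) + x (a, b) := by
    rintro s a b hab ⟨l, hl⟩
    refine ⟨⟨_, lenSet_snoc E x hab hl⟩, ?_⟩
    rw [← sub_le_iff_le_add]
    refine le_csInf ⟨l, hl⟩ fun l' hl' => ?_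
    rw [sub_le_iff_le_add]
    exact csInf_le (hbdd _ _) (lenSet_snoc E x hab hl')
  have hT := fun a : V => aux_T F k hH (fun s => (L s a).Nonempty) (fun s => sInf (L s a))
  choose T hTc hT using hT
  obtain ⟨θ, hθ0, hθ1, hθ⟩ := aux_avg E w x (fun e => T e.1) ((k : ℝ) - 1) hw hx0
    (fun e _ => hTc e.1)
  let Q : V → V → Prop := fun t v => ∃ s, (s, t) ∈ F ∧ (L s v).Nonempty ∧ sInf (L s v) ≤ θ
  refine ⟨E.filter fun e => ∃ t, Q t e.1 ∧ ¬ Q t e.2, Finset.filter_subset _ _, ?_, ?_⟩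
  · rintro ⟨s, t⟩ hst hr
    have key : Q t t := by
      simp only at hr
      have hind : ∀ v, Relation.ReflTransGen (fun a b => (a, b) ∈ E ∧ (a, b) ∉
          E.filter fun e => ∃ t, Q t e.1 ∧ ¬ Q t e.2) s v → Q t v := by
        intro v hv
        induction hv with
        | refl => exact ⟨s, hst, ⟨0, lenSet_self E x s⟩,
            (csInf_le (hbdd _ _) (lenSet_self E x s)).trans hθ0⟩
        | tail _ h ih =>
          by_contra hq
          exact h.2 (Finset.mem_filter.2 ⟨h.1, t, ih, hq⟩)
      exact hind t hr
    obtain ⟨s', hs', hne, hle⟩ := key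
    have : 1 ≤ sInf (L s' t) := by
      refine le_csInf hne ?_
      rintro l ⟨p, h1, h2, rfl⟩
      exact hxfeas (s', t) hs' p h1 h2
    linarith
  · refine le_trans ?_ hθ
    rw [Finset.sum_filter]
    apply Finset.sum_le_sum
    rintro ⟨a, b⟩ he
    have hnn : ∀ c ∈ T a, 0 ≤ (Set.Icc c (c + x (a, b))).indicator (fun _ => (1 : ℝ)) θ :=
      fun c _ => Set.indicator_nonneg (fun _ _ => zero_le_one) θ
    split_ifs with hcut
    · obtain ⟨t, ⟨s, hst, hne, hle⟩, hnq⟩ := hcut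
      obtain ⟨c, hc, hcs, s', hs't, hne', hd⟩ := hT a s t hst hne
      obtain ⟨hneb, hleb⟩ := hstep s' a b he hne'
      have hlt : θ < sInf (L s' b) := by
        by_contra hcon
        exact hnq ⟨s', hs't, hneb, not_lt.1 hcon⟩
      have hmem : θ ∈ Set.Icc c (c + x (a, b)) :=
        ⟨hcs.trans hle, by linarith⟩
      have h1 := Finset.single_le_sum hnn hc
      rw [Set.indicator_of_mem hmem] at h1
      exact le_mul_of_one_le_right (hw _ he) h1
    · exact mul_nonneg (hw _ he) (Finset.sum_nonneg hnn)
end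

section
/- Let V be a vertex set of even size, let M be a perfect matching on V (a partition of V into unordered pairs), and let H=(V,F) be the directed graph with F = {(u,v) : u,v∈V, u≠v, {u,v}∉M} (the complete directed graph minus both directions of each matched pair). Then H does not contain an induced 4-matching-extension: there do not exist vertices s_1,…,s_4 (pairwise distinct) and t_1,…,t_4 (pairwise distinct; an s_i may coincide with a t_j) such that (s_i,t_i)∈F for all i∈{1,…,4} and (s_i,t_j)∉F whenever i > j. -/
/-- Let `V` be a finite vertex set carrying a perfect matching, encoded
as a fixed-point-free involution `M : V → V` (so `V` is partitioned into the unordered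
pairs `{v, M v}`, forcing `|V|` even).  Let `H` be the complete directed graph minus
both directions of every matched pair, i.e. with edge set
`F = {(u,v) : u ≠ v ∧ v ≠ M u}`.  Then `H` contains no induced
`4`-matching-extension. -/
theorem stmt_17 {V : Type*} [Fintype V] (M : V → V)
    (hinv : ∀ v, M (M v) = v) (hnofix : ∀ v, M v ≠ v) :
    ¬ HasKMatchingExtension {e : V × V | e.1 ≠ e.2 ∧ e.2 ≠ M e.1} 4 := by
  rintro ⟨s, t, hs, -, -, h⟩
  have key : ∀ i : Fin 4, 0 < i → s i = t 0 ∨ s i = M (t 0) := by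
    intro i hi
    by_contra hc
    push Not at hc
    exact h i 0 hi ⟨hc.1, fun e => hc.2 (by
      have e2 : t 0 = M (s i) := e
      rw [e2, hinv])⟩
  have h12 : s 1 ≠ s 2 := fun e => absurd (hs e) (by decide)
  have h13 : s 1 ≠ s 3 := fun e => absurd (hs e) (by decide)
  have h23 : s 2 ≠ s 3 := fun e => absurd (hs e) (by decide)
  have k1 := key 1 (by decide)
  have k2 := key 2 (by decide)
  have k3 := key 3 (by decide)
  grind
end
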